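/- arXiv:1103.5271 — 2 statements merged into one kernel-verified Lean document; each statement's English description precedes it below -/
import Mathlib

section
/- For every ε > 0 there exists C > 0, independent of J and N, such that the following holds for every integer J ≥ 2, every real N ≥ 1, and every v ∈ ℓ²(ℤ; ℂ). For n ∈ ℤ consider all families of frequencies defined recursively by n^{(1)} := n and, for j = 1, …, J, triples (a_j, b_j, c_j) ∈ ℤ³ with a_j − b_j + c_j = n^{(j)}, b_j ∉ {a_j, c_j}, and n^{(j+1)} := a_j; set μ_j := 2(n^{(j)} − a_j)(n^{(j)} − c_j) and μ̃_j := μ₁ + ⋯ + μ_j, and impose |μ₁| > N and, for j = 2, …, J, |μ̃_j| > (2j+1)³ · max(|μ̃_{j−1}|^{1 − 1/100}, |μ₁|^{1 − 1/100}). Define Q(n) := ∑ over all such families of (∏_{k=1}^{J} 1/|μ̃_k|) · |v_{a_J}| · ∏_{j=1}^{J} (|v_{b_j}| · |v_{c_j}|). Then Q is finite for every n, belongs to ℓ²(ℤ), and ‖Q‖ ≤ C N^{−J/2 + (J−1)/200 + Jε} ‖v‖^{2J+1}. -/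
open scoped BigOperators

/-- The ℓ²(ℤ;ℂ) norm `(∑ₙ |vₙ|²)^{1/2}`. -/
noncomputable def l2norm (v : ℤ → ℂ) : ℝ := Real.sqrt (∑' n : ℤ, ‖v n‖ ^ 2)

/-- Membership in ℓ²(ℤ;ℂ). -/
def Memℓ2 (v : ℤ → ℂ) : Prop := Summable fun n : ℤ => ‖v n‖ ^ 2

/-- The parent frequency `n^{(j)}` of the `j`-th generation of the first-child chain:
`n^{(0)} = n` and `n^{(j)} = a_{j-1}` for `j ≥ 1` (0-indexed generations), where
`f j = (a_j, b_j, c_j)`. -/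
def ngen (n : ℤ) {J : ℕ} (f : Fin J → ℤ × ℤ × ℤ) (j : Fin J) : ℤ :=
  if j.1 = 0 then n
  else (f ⟨j.1 - 1, lt_of_le_of_lt (Nat.sub_le _ _) j.isLt⟩).1

/-- The phase `μ_j = 2(n^{(j)} − a_j)(n^{(j)} − c_j)` introduced at the `j`-th generation. -/
def muGen (n : ℤ) {J : ℕ} (f : Fin J → ℤ × ℤ × ℤ) (j : Fin J) : ℤ :=
  2 * (ngen n f j - (f j).1) * (ngen n f j - (f j).2.2)

/-- The accumulated phase `μ̃_j = μ₀ + ⋯ + μ_j` (0-indexed). -/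
def mutGen (n : ℤ) {J : ℕ} (f : Fin J → ℤ × ℤ × ℤ) (j : Fin J) : ℤ :=
  ∑ k ∈ Finset.Iic j, muGen n f k

/-- The first-child chain conditions of `J` generations with all accumulated phases
non-resonant: for every `j`, `a_j − b_j + c_j = n^{(j)}` and `b_j ∉ {a_j, c_j}`;
`|μ₁| > N`; and for the `j`-th generation with `j ≥ 1` (0-indexed, i.e. generation `j+1`
in 1-indexed notation), `|μ̃_j| > (2(j+1)+1)³ max(|μ̃_{j-1}|^{1−1/100}, |μ₁|^{1−1/100})`. -/
def validChain (N : ℝ) (n : ℤ) {J : ℕ} (f : Fin J → ℤ × ℤ × ℤ) : Prop :=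
  (∀ j : Fin J, (f j).1 - (f j).2.1 + (f j).2.2 = ngen n f j ∧
    (f j).2.1 ≠ (f j).1 ∧ (f j).2.1 ≠ (f j).2.2) ∧
  (∀ j : Fin J, j.1 = 0 → N < |((muGen n f j : ℤ) : ℝ)|) ∧
  (∀ j : Fin J, 1 ≤ j.1 →
    ((2 * j.1 + 3 : ℕ) : ℝ) ^ 3 *
      max (|((mutGen n f ⟨j.1 - 1, lt_of_le_of_lt (Nat.sub_le _ _) j.isLt⟩ : ℤ) : ℝ)|
            ^ ((1:ℝ) - 1/100))
          (|((muGen n f ⟨0, j.pos⟩ : ℤ) : ℝ)| ^ ((1:ℝ) - 1/100))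
      < |((mutGen n f j : ℤ) : ℝ)|)

/-- The frequency `a_J` of the last expanded child of the chain (junk value for `J = 0`). -/
def alast (n : ℤ) {J : ℕ} (f : Fin J → ℤ × ℤ × ℤ) : ℤ :=
  if h : 0 < J then (f ⟨J - 1, Nat.sub_lt h one_pos⟩).1 else n

/-- The summand `(∏_k 1/|μ̃_k|) |v_{a_J}| ∏_j |v_{b_j}| |v_{c_j}|` of the boundary term
`N^{(J+1)}₀`. -/
noncomputable def term12 (v : ℤ → ℂ) (n : ℤ) {J : ℕ} (f : Fin J → ℤ × ℤ × ℤ) : ℝ :=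
  (∏ k : Fin J, 1 / |((mutGen n f k : ℤ) : ℝ)|) * ‖v (alast n f)‖ *
    ∏ j : Fin J, (‖v (f j).2.1‖ * ‖v (f j).2.2‖)

/-- The majorant `Q(n)` of the boundary term `N^{(J+1)}₀` (first-child chain tree). -/
noncomputable def Q12 (N : ℝ) (v : ℤ → ℂ) (J : ℕ) (n : ℤ) : ℝ :=
  ∑' f : {f : Fin J → ℤ × ℤ × ℤ // validChain N n f}, term12 v n f.1

/-- The divisor bound `d(n) ≤ D n ^ δ`. -/
theorem card_divisors_le_rpow {δ : ℝ} (hδ : 0 < δ) :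
    ∃ D : ℝ, 1 ≤ D ∧ ∀ n : ℕ, n ≠ 0 → (n.divisors.card : ℝ) ≤ D * (n : ℝ) ^ δ := by
  have hlog : 0 < Real.log 2 := Real.log_pos (by norm_num)
  set K : ℝ := 1 + 1 / (δ * Real.log 2) with hK
  have hK1 : 1 ≤ K := by rw [hK]; linarith [show 0 ≤ 1 / (δ * Real.log 2) by positivity]
  set P : ℕ := ⌈(2 : ℝ) ^ (1 / δ)⌉₊ with hP
  have factor_le : ∀ p : ℕ, p.Prime → ∀ e : ℕ,
      ((e + 1 : ℕ) : ℝ) ≤ (if p < P then K else 1) * (((p ^ e : ℕ) : ℝ)) ^ δ := by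
    intro p hp e
    have hpow : (((p ^ e : ℕ) : ℝ)) ^ δ = ((p : ℝ) ^ δ) ^ e := by
      push_cast
      rw [← Real.rpow_natCast_mul (by positivity), mul_comm, Real.rpow_mul_natCast (by positivity)]
    rw [hpow]
    split_ifs with h
    · have h2 : (2 : ℝ) ≤ p := by exact_mod_cast hp.two_le
      have h3 : 1 + (e : ℝ) * (δ * Real.log 2) ≤ ((p : ℝ) ^ δ) ^ e := by
        calc 1 + (e : ℝ) * (δ * Real.log 2) ≤ Real.exp ((e : ℝ) * (δ * Real.log 2)) := by
              linarith [Real.add_one_le_exp ((e : ℝ) * (δ * Real.log 2))]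
          _ = ((2 : ℝ) ^ δ) ^ e := by
              rw [Real.exp_nat_mul, Real.rpow_def_of_pos (by norm_num), mul_comm δ]
          _ ≤ _ := by gcongr
      calc ((e + 1 : ℕ) : ℝ) ≤ K * (1 + (e : ℝ) * (δ * Real.log 2)) := by
            have : K * (1 + (e : ℝ) * (δ * Real.log 2))
                = 1 + e + (e * (δ * Real.log 2) + 1 / (δ * Real.log 2)) := by
              rw [hK]; field_simp; ring
            rw [this]; push_cast
            have : 0 ≤ (e * (δ * Real.log 2) + 1 / (δ * Real.log 2)) := by positivity
            linarith
        _ ≤ _ := by gcongr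
    · have h2 : (2 : ℝ) ≤ (p : ℝ) ^ δ := by
        have h4 : (2 : ℝ) ^ (1 / δ) ≤ p := Nat.ceil_le.mp (not_lt.mp h)
        calc (2 : ℝ) = ((2 : ℝ) ^ (1 / δ)) ^ δ := by
              rw [← Real.rpow_mul (by norm_num), one_div_mul_cancel hδ.ne', Real.rpow_one]
          _ ≤ _ := by gcongr
      calc ((e + 1 : ℕ) : ℝ) ≤ 2 ^ e := by exact_mod_cast Nat.lt_two_pow_self
        _ ≤ _ := by rw [one_mul]; gcongr
  refine ⟨K ^ P, one_le_pow₀ hK1, fun n hn => ?_⟩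
  have hprod : (n : ℝ) ^ δ = ∏ p ∈ n.primeFactors, (((p ^ n.factorization p : ℕ) : ℝ)) ^ δ := by
    conv_lhs => rw [← Nat.prod_factorization_pow_eq_self hn]
    rw [Finsupp.prod, Nat.cast_prod, ← Real.finsetProd_rpow _ _ (fun _ _ => by positivity)]
    rfl
  rw [Nat.card_divisors hn, Nat.cast_prod, hprod]
  calc ∏ p ∈ n.primeFactors, ((n.factorization p + 1 : ℕ) : ℝ)
      ≤ ∏ p ∈ n.primeFactors, ((if p < P then K else 1) *
          (((p ^ n.factorization p : ℕ) : ℝ)) ^ δ) :=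
        Finset.prod_le_prod (fun _ _ => by positivity)
          (fun p hp => factor_le p (Nat.prime_of_mem_primeFactors hp) _)
    _ = (∏ p ∈ n.primeFactors, (if p < P then K else 1)) *
          ∏ p ∈ n.primeFactors, (((p ^ n.factorization p : ℕ) : ℝ)) ^ δ :=
        Finset.prod_mul_distrib
    _ ≤ _ := by
        gcongr
        rw [Finset.prod_ite, Finset.prod_const, Finset.prod_const_one, mul_one]
        apply pow_le_pow_right₀ hK1
        calc _ ≤ (Finset.range P).card := Finset.card_le_card fun p hp => by
              simp only [Finset.mem_filter] at hp; simpa using hp.2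
          _ = P := Finset.card_range P

/-- A nonzero integer `z` is a product of two integers in at most `2 d(|z|)` ways. -/
theorem encard_mul_eq_le {z : ℤ} (hz : z ≠ 0) :
    {p : ℤ × ℤ | p.1 * p.2 = z}.encard ≤ ((2 * z.natAbs.divisors.card : ℕ) : ℕ∞) := by
  have hinj : Set.InjOn (fun p : ℤ × ℤ => (p.1.natAbs, decide (0 ≤ p.1)))
      {p : ℤ × ℤ | p.1 * p.2 = z} := by
    rintro ⟨x, y⟩ h ⟨x', y'⟩ h' heq
    simp only [Set.mem_ofPred_eq, Prod.mk.injEq, decide_eq_decide] at h h' heq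
    have hx : x = x' := by omega
    subst hx
    have hx0 : x ≠ 0 := by rintro rfl; simp at h; exact hz h.symm
    rw [mul_left_cancel₀ hx0 (h.trans h'.symm)]
  rw [← hinj.encard_image]
  calc _ ≤ ((z.natAbs.divisors ×ˢ (Finset.univ : Finset Bool) : Finset (ℕ × Bool)) :
        Set (ℕ × Bool)).encard := by
        apply Set.encard_le_encard
        rintro _ ⟨⟨x, y⟩, h, rfl⟩
        simp only [Set.mem_ofPred_eq] at h
        simp only [Finset.coe_product, Set.mem_prod, Finset.mem_coe, Nat.mem_divisors,
          Finset.mem_univ, and_true]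
        exact ⟨Int.natAbs_dvd_natAbs.mpr ⟨y, h.symm⟩, by simpa using hz⟩
    _ = _ := by rw [Set.encard_coe_eq_coe_finsetCard, Finset.card_product]; simp [mul_comm]

/-- The admissible triples `(a, b, c)` expanding the frequency `m` when the phase accumulated so
far is `T`: the new accumulated phase exceeds `M` and dominates `|T| ^ (1 - 1/100)`. -/
def nonresonantTriples (m T : ℤ) (M : ℝ) : Set (ℤ × ℤ × ℤ) :=
  {t | t.1 - t.2.1 + t.2.2 = m ∧ t.2.1 ≠ t.1 ∧ t.2.1 ≠ t.2.2 ∧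
    M < |((T + 2 * (m - t.1) * (m - t.2.2) : ℤ) : ℝ)| ∧
    |(T : ℝ)| ^ ((1 : ℝ) - 1 / 100) ≤ |((T + 2 * (m - t.1) * (m - t.2.2) : ℤ) : ℝ)|}

theorem encard_fiber_nonresonantTriples_le {δ D : ℝ} (hδ : 0 < δ)
    (hD : ∀ n : ℕ, n ≠ 0 → (n.divisors.card : ℝ) ≤ D * (n : ℝ) ^ (δ / 2)) (hD1 : 1 ≤ D)
    (m T ν : ℤ) {M : ℝ} (hM : 1 ≤ M) :
    ((((fun t : ℤ × ℤ × ℤ => T + 2 * (m - t.1) * (m - t.2.2)) ⁻¹' {ν} ∩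
      nonresonantTriples m T M).encard : ℕ∞) : ENNReal) ≤
      ENNReal.ofReal (2 * D * |(ν : ℝ)| ^ δ) := by
  rcases Set.eq_empty_or_nonempty ((fun t : ℤ × ℤ × ℤ => T + 2 * (m - t.1) * (m - t.2.2)) ⁻¹' {ν} ∩
      nonresonantTriples m T M) with h0 | ⟨t₀, ht₀, hs₀⟩
  · rw [h0]; simp
  · obtain ⟨e1, e2, e3, e4, e5⟩ := hs₀
    simp only [Set.mem_preimage, Set.mem_singleton_iff] at ht₀
    rw [ht₀] at e4 e5
    set z := (m - t₀.1) * (m - t₀.2.2) with hz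
    have hz0 : z ≠ 0 := by
      apply mul_ne_zero <;> omega
    have hν : ν = T + 2 * z := by rw [← ht₀, hz]; ring
    have hν1 : 1 ≤ |(ν : ℝ)| := hM.trans e4.le
    have hT : |(T : ℝ)| ≤ |(ν : ℝ)| ^ 2 := by
      calc |(T : ℝ)| = (|(T : ℝ)| ^ ((1 : ℝ) - 1 / 100)) ^ ((1 - 1 / 100 : ℝ)⁻¹) := by
            rw [← Real.rpow_mul (abs_nonneg _), mul_inv_cancel₀ (by norm_num), Real.rpow_one]
        _ ≤ |(ν : ℝ)| ^ ((1 - 1 / 100 : ℝ)⁻¹) := by gcongr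
        _ ≤ |(ν : ℝ)| ^ (2 : ℝ) := Real.rpow_le_rpow_of_exponent_le hν1 (by norm_num)
        _ = _ := by norm_num
    have hzν : (z.natAbs : ℝ) ≤ |(ν : ℝ)| ^ 2 := by
      rw [Nat.cast_natAbs, Int.cast_abs]
      have h1 : (2 * z : ℝ) = ν - T := by rw [hν]; push_cast; ring
      have h2 : 2 * |(z : ℝ)| ≤ |(ν : ℝ)| + |(T : ℝ)| := by
        calc 2 * |(z : ℝ)| = |(2 * z : ℝ)| := by rw [abs_mul]; simp
          _ ≤ _ := by rw [h1]; exact abs_sub _ _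
      nlinarith
    have hcard : (((fun t : ℤ × ℤ × ℤ => T + 2 * (m - t.1) * (m - t.2.2)) ⁻¹' {ν} ∩
        nonresonantTriples m T M).encard) ≤ ((2 * z.natAbs.divisors.card : ℕ) : ℕ∞) := by
      refine le_trans ?_ (encard_mul_eq_le hz0)
      refine Set.encard_le_encard_of_injOn (f := fun t => (m - t.1, m - t.2.2)) ?_ ?_
      · rintro ⟨a, b, c⟩ ⟨h, -⟩
        simp only [Set.mem_preimage, Set.mem_singleton_iff] at h
        show (m - a) * (m - c) = z
        linarith
      · rintro ⟨a, b, c⟩ ⟨-, h, -⟩ ⟨a', b', c'⟩ ⟨-, h', -⟩ heq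
        simp only [Prod.mk.injEq] at h h' heq ⊢
        omega
    calc _ ≤ ((((2 * z.natAbs.divisors.card : ℕ) : ℕ∞)) : ENNReal) := by exact_mod_cast hcard
      _ = ENNReal.ofReal ((2 * z.natAbs.divisors.card : ℕ) : ℝ) := by
          rw [ENNReal.ofReal_natCast]; simp
      _ ≤ _ := by
          apply ENNReal.ofReal_le_ofReal
          push_cast
          have := hD z.natAbs (by simpa using hz0)
          have h3 : (z.natAbs : ℝ) ^ (δ / 2) ≤ |(ν : ℝ)| ^ δ := by
            calc (z.natAbs : ℝ) ^ (δ / 2) ≤ (|(ν : ℝ)| ^ 2) ^ (δ / 2) := by gcongr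
              _ = _ := by
                rw [← Real.rpow_natCast_mul (abs_nonneg _)]; congr 1; push_cast; ring
          nlinarith

/-- Summing the inverse square of the accumulated phase over one generation gains almost one
power of the lower bound on that phase, uniformly in the frequency and the previous phase. -/
theorem exists_tsum_nonresonantTriples_le {δ : ℝ} (hδ : 0 < δ) (hδ' : δ ≤ 1 / 2) :
    ∃ C : ℝ, 0 < C ∧ ∀ (m T : ℤ) (M : ℝ), 1 ≤ M →
      ∑' t, (nonresonantTriples m T M).indicator (fun t => ENNReal.ofReal
        ((1 / |((T + 2 * (m - t.1) * (m - t.2.2) : ℤ) : ℝ)|) ^ 2)) t ≤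
      ENNReal.ofReal (C * M ^ (-(1 - 2 * δ))) := by
  obtain ⟨D, hD1, hD⟩ := card_divisors_le_rpow (half_pos hδ)
  have hsum : Summable fun ν : ℤ => |(ν : ℝ)| ^ (-(1 + δ)) :=
    Real.summable_abs_int_rpow (by linarith)
  have hpos : 0 < ∑' ν : ℤ, |(ν : ℝ)| ^ (-(1 + δ)) :=
    hsum.tsum_pos (fun _ => by positivity) 1 (by simp)
  refine ⟨2 * D * ∑' ν : ℤ, |(ν : ℝ)| ^ (-(1 + δ)), by positivity, fun m T M hM => ?_⟩
  have hM0 : 0 < M := by linarith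
  set φ : ℤ × ℤ × ℤ → ℤ := fun t => T + 2 * (m - t.1) * (m - t.2.2) with hφ
  set S := nonresonantTriples m T M with hS
  have hfib : ∀ ν : ℤ, ∑' t : φ ⁻¹' {ν}, S.indicator
      (fun t => ENNReal.ofReal ((1 / |((φ t : ℤ) : ℝ)|) ^ 2)) t ≤
      ENNReal.ofReal (2 * D * M ^ (-(1 - 2 * δ)) * |(ν : ℝ)| ^ (-(1 + δ))) := by
    intro ν
    rw [tsum_subtype (φ ⁻¹' {ν}) (S.indicator
      (fun t => ENNReal.ofReal ((1 / |((φ t : ℤ) : ℝ)|) ^ 2))), Set.indicator_indicator]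
    have hconst : (φ ⁻¹' {ν} ∩ S).indicator
        (fun t => ENNReal.ofReal ((1 / |((φ t : ℤ) : ℝ)|) ^ 2)) =
        (φ ⁻¹' {ν} ∩ S).indicator (fun _ => ENNReal.ofReal ((1 / |(ν : ℝ)|) ^ 2)) := by
      apply Set.indicator_congr
      intro t ht
      simp only [show φ t = ν from ht.1]
    rw [hconst, ← tsum_subtype, ENNReal.tsum_set_const]
    rcases Set.eq_empty_or_nonempty (φ ⁻¹' {ν} ∩ S) with h0 | ⟨t₀, ht₀, hs₀⟩
    · rw [h0]; simp
    have hMν : M < |(ν : ℝ)| := by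
      have := hs₀.2.2.2.1
      rwa [show T + 2 * (m - t₀.1) * (m - t₀.2.2) = ν from ht₀] at this
    have hν0 : 0 < |(ν : ℝ)| := hM0.trans hMν
    calc _ ≤ ENNReal.ofReal (2 * D * |(ν : ℝ)| ^ δ) * ENNReal.ofReal ((1 / |(ν : ℝ)|) ^ 2) := by
          gcongr
          exact encard_fiber_nonresonantTriples_le hδ hD hD1 m T ν hM
      _ = ENNReal.ofReal (2 * D * (|(ν : ℝ)| ^ δ * (1 / |(ν : ℝ)|) ^ 2)) := by
          rw [← ENNReal.ofReal_mul (by positivity), mul_assoc]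
      _ ≤ _ := by
          apply ENNReal.ofReal_le_ofReal
          rw [mul_assoc (2 * D)]
          refine mul_le_mul_of_nonneg_left ?_ (by positivity)
          have : |(ν : ℝ)| ^ δ * (1 / |(ν : ℝ)|) ^ 2 =
              |(ν : ℝ)| ^ (-(1 - 2 * δ)) * |(ν : ℝ)| ^ (-(1 + δ)) := by
            rw [one_div, inv_pow, ← Real.rpow_natCast, ← Real.rpow_neg hν0.le,
              ← Real.rpow_add hν0, ← Real.rpow_add hν0]
            congr 1; push_cast; ring
          rw [this]
          exact mul_le_mul_of_nonneg_right
            (Real.rpow_le_rpow_of_nonpos hM0 hMν.le (by linarith)) (by positivity)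
  rw [← ENNReal.tsum_fiberwise _ φ]
  refine (ENNReal.tsum_le_tsum hfib).trans (le_of_eq ?_)
  rw [← ENNReal.ofReal_tsum_of_nonneg (fun _ => by positivity) (hsum.mul_left _), tsum_mul_left]
  congr 1; ring

section Snoc

variable {J : ℕ} (n : ℤ) (g : Fin J → ℤ × ℤ × ℤ) (t : ℤ × ℤ × ℤ)

theorem ngen_snoc_castSucc (j : Fin J) :
    ngen n (Fin.snoc (α := fun _ => ℤ × ℤ × ℤ) g t) j.castSucc = ngen n g j := by
  unfold ngen
  by_cases h : j.1 = 0
  · simp [h]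
  · have h2 : j.1 - 1 < J := by omega
    simp [h, Fin.snoc, h2]

theorem ngen_snoc_last :
    ngen n (Fin.snoc (α := fun _ => ℤ × ℤ × ℤ) g t) (Fin.last J) = alast n g := by
  unfold ngen alast
  by_cases h : J = 0
  · simp [h]
  · have h2 : J - 1 < J := by omega
    simp [h, Fin.snoc, h2, Nat.pos_of_ne_zero h]

theorem alast_snoc : alast n (Fin.snoc (α := fun _ => ℤ × ℤ × ℤ) g t) = t.1 := by
  simp [alast, Fin.snoc]

theorem muGen_snoc_castSucc (j : Fin J) :
    muGen n (Fin.snoc (α := fun _ => ℤ × ℤ × ℤ) g t) j.castSucc = muGen n g j := by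
  simp [muGen, ngen_snoc_castSucc]

theorem muGen_snoc_last :
    muGen n (Fin.snoc (α := fun _ => ℤ × ℤ × ℤ) g t) (Fin.last J) =
      2 * (alast n g - t.1) * (alast n g - t.2.2) := by
  simp [muGen, ngen_snoc_last]

theorem mutGen_snoc_castSucc (j : Fin J) :
    mutGen n (Fin.snoc (α := fun _ => ℤ × ℤ × ℤ) g t) j.castSucc = mutGen n g j := by
  simp [mutGen, Fin.sum_Iic_castSucc, muGen_snoc_castSucc]

theorem mutGen_snoc_last :
    mutGen n (Fin.snoc (α := fun _ => ℤ × ℤ × ℤ) g t) (Fin.last J) =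
      (∑ k, muGen n g k) + 2 * (alast n g - t.1) * (alast n g - t.2.2) := by
  have : Finset.Iic (Fin.last J) = Finset.univ := by ext; simp [Fin.le_last]
  rw [mutGen, this, Fin.sum_univ_castSucc]
  simp [muGen_snoc_castSucc, muGen_snoc_last]

end Snoc

/-- The lower bound on the accumulated phase of the generation with (0-based) index `k`. -/
noncomputable def phaseThreshold (N : ℝ) (k : ℕ) : ℝ :=
  if k = 0 then N else ((2 * k + 3 : ℕ) : ℝ) ^ 3 * N ^ ((1 : ℝ) - 1 / 100)

theorem one_le_phaseThreshold {N : ℝ} (hN : 1 ≤ N) (k : ℕ) : 1 ≤ phaseThreshold N k := by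
  unfold phaseThreshold
  split_ifs
  · exact hN
  · exact one_le_mul_of_one_le_of_one_le (one_le_pow₀ (by norm_cast; omega))
      (Real.one_le_rpow hN (by norm_num))

theorem validChain_of_snoc {N : ℝ} (hN : 1 ≤ N) {n : ℤ} {J : ℕ} {g : Fin J → ℤ × ℤ × ℤ}
    {t : ℤ × ℤ × ℤ} (h : validChain N n (Fin.snoc (α := fun _ => ℤ × ℤ × ℤ) g t)) :
    validChain N n g ∧
      t ∈ nonresonantTriples (alast n g) (∑ k, muGen n g k) (phaseThreshold N J) := by
  obtain ⟨h1, h2, h3⟩ := h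
  have hg : validChain N n g := by
    refine ⟨fun j => ?_, fun j hj => ?_, fun j hj => ?_⟩
    · have := h1 j.castSucc
      simpa only [Fin.snoc_castSucc, ngen_snoc_castSucc] using this
    · have := h2 j.castSucc hj
      rwa [muGen_snoc_castSucc] at this
    · have := h3 j.castSucc hj
      rw [mutGen_snoc_castSucc] at this
      have e1 := mutGen_snoc_castSucc n g t ⟨j.1 - 1, lt_of_le_of_lt (Nat.sub_le _ _) j.isLt⟩
      have e2 := muGen_snoc_castSucc n g t ⟨0, j.pos⟩
      rw [← e1, ← e2]
      exact this
  refine ⟨hg, ?_⟩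
  have hl := h1 (Fin.last J)
  rw [ngen_snoc_last, Fin.snoc_last] at hl
  refine ⟨hl.1, hl.2.1, hl.2.2, ?_⟩
  rw [← mutGen_snoc_last]
  rcases Nat.eq_zero_or_pos J with rfl | hJ
  · have h4 := h2 (Fin.last 0) rfl
    have h5 : mutGen n (Fin.snoc (α := fun _ => ℤ × ℤ × ℤ) g t) (Fin.last 0) =
        muGen n (Fin.snoc (α := fun _ => ℤ × ℤ × ℤ) g t) (Fin.last 0) := by
      rw [mutGen_snoc_last, muGen_snoc_last]; simp
    rw [h5]
    refine ⟨by simpa [phaseThreshold] using h4, ?_⟩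
    rw [Finset.univ_eq_empty, Finset.sum_empty, Int.cast_zero, abs_zero,
      Real.zero_rpow (by norm_num)]
    positivity
  · have h4 := h3 (Fin.last J) hJ
    have e1 := mutGen_snoc_castSucc n g t ⟨J - 1, Nat.sub_lt hJ one_pos⟩
    have e2 := muGen_snoc_castSucc n g t ⟨0, hJ⟩
    have e3 : mutGen n g ⟨J - 1, Nat.sub_lt hJ one_pos⟩ = ∑ k, muGen n g k := by
      have : Finset.Iic (⟨J - 1, Nat.sub_lt hJ one_pos⟩ : Fin J) = Finset.univ := by
        ext k; simp only [Finset.mem_Iic, Finset.mem_univ, iff_true, Fin.le_def]; omega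
      rw [mutGen, this]
    rw [e3] at e1
    have h5 : N < |((muGen n g ⟨0, hJ⟩ : ℤ) : ℝ)| := hg.2.1 ⟨0, hJ⟩ rfl
    have h6 : ((2 * J + 3 : ℕ) : ℝ) ^ 3 *
      max (|((∑ k, muGen n g k : ℤ) : ℝ)| ^ ((1:ℝ) - 1/100))
          (|((muGen n g ⟨0, hJ⟩ : ℤ) : ℝ)| ^ ((1:ℝ) - 1/100)) <
        |((mutGen n (Fin.snoc (α := fun _ => ℤ × ℤ × ℤ) g t) (Fin.last J) : ℤ) : ℝ)| := by
      rw [← e1, ← e2]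
      exact h4
    constructor
    · refine lt_of_le_of_lt ?_ h6
      rw [phaseThreshold, if_neg hJ.ne']
      gcongr
      exact le_max_of_le_right (Real.rpow_le_rpow (by linarith) h5.le (by norm_num))
    · refine le_trans (le_max_left _ (|((muGen n g ⟨0, hJ⟩ : ℤ) : ℝ)| ^ ((1:ℝ) - 1/100))) ?_
      refine le_trans (le_mul_of_one_le_left (le_max_of_le_left (by positivity)) ?_) h6.le
      exact one_le_pow₀ (by norm_cast; omega)

theorem tsum_fin_succ_eq {J : ℕ} {α : Type*} (F : (Fin (J + 1) → α) → ENNReal) :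
    ∑' f, F f = ∑' g : Fin J → α, ∑' t : α, F (Fin.snoc (α := fun _ => α) g t) := by
  rw [← (Fin.snocEquiv (fun _ : Fin (J + 1) => α)).tsum_eq F, ENNReal.tsum_comm,
    ← ENNReal.tsum_prod (f := fun t g => F (Fin.snoc (α := fun _ => α) g t))]
  rfl

theorem tsum_validChain_le {N C s : ℝ} (hN : 1 ≤ N)
    (hC : ∀ (m T : ℤ) (M : ℝ), 1 ≤ M →
      ∑' t, (nonresonantTriples m T M).indicator (fun t => ENNReal.ofReal
        ((1 / |((T + 2 * (m - t.1) * (m - t.2.2) : ℤ) : ℝ)|) ^ 2)) t ≤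
      ENNReal.ofReal (C * M ^ s)) (n : ℤ) (J : ℕ) :
    ∑' f : Fin J → ℤ × ℤ × ℤ, {f | validChain N n f}.indicator (fun f =>
      ∏ k, ENNReal.ofReal ((1 / |((mutGen n f k : ℤ) : ℝ)|) ^ 2)) f ≤
      ∏ k ∈ Finset.range J, ENNReal.ofReal (C * phaseThreshold N k ^ s) := by
  induction J with
  | zero =>
    rw [tsum_eq_single default (fun f hf => absurd (Subsingleton.elim f default) hf)]
    refine (Set.indicator_le_self' (fun _ _ => zero_le) _).trans ?_
    simp
  | succ J ih =>
    rw [tsum_fin_succ_eq, Finset.prod_range_succ]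
    refine le_trans (ENNReal.tsum_le_tsum fun g => ?_)
      ((ENNReal.tsum_mul_right).le.trans (mul_le_mul_left ih _))
    refine le_trans (ENNReal.tsum_le_tsum fun t => ?_)
      (ENNReal.tsum_mul_left.le.trans (mul_le_mul_right
        (hC (alast n g) (∑ k, muGen n g k) _ (one_le_phaseThreshold hN J)) _))
    by_cases h : validChain N n (Fin.snoc (α := fun _ => ℤ × ℤ × ℤ) g t)
    · obtain ⟨hg, ht⟩ := validChain_of_snoc hN h
      rw [Set.indicator_of_mem (by exact h), Set.indicator_of_mem (by exact hg),
        Set.indicator_of_mem ht, Fin.prod_univ_castSucc, mutGen_snoc_last]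
      simp [mutGen_snoc_castSucc]
    · rw [Set.indicator_of_notMem (by exact h)]
      exact zero_le

theorem prod_phaseThreshold_le {N C s : ℝ} (hN : 1 ≤ N) (hC : 0 ≤ C) (hs : s ≤ -(2 / 3))
    (J : ℕ) :
    ∏ k ∈ Finset.range (J + 1), (C * phaseThreshold N k ^ s) ≤
      Real.exp C * N ^ (s * (1 + (1 - 1 / 100) * J)) := by
  have key : ∏ k ∈ Finset.range (J + 1), (C * phaseThreshold N k ^ s) ≤
      C ^ (J + 1) / ((J + 1).factorial : ℝ) * N ^ (s * (1 + (1 - 1 / 100) * J)) := by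
    induction J with
    | zero => simp [phaseThreshold]
    | succ J ih =>
      rw [Finset.prod_range_succ]
      have hx : ((2 * (J + 1) + 3 : ℕ) : ℝ) ^ (3 * s) ≤ 1 / ((J + 1 + 1 : ℕ) : ℝ) := by
        calc ((2 * (J + 1) + 3 : ℕ) : ℝ) ^ (3 * s) ≤ ((2 * (J + 1) + 3 : ℕ) : ℝ) ^ (-1 : ℝ) := by
              apply Real.rpow_le_rpow_of_exponent_le
              · norm_cast; omega
              · linarith
          _ = 1 / ((2 * (J + 1) + 3 : ℕ) : ℝ) := by rw [Real.rpow_neg_one, one_div]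
          _ ≤ _ := by
            apply one_div_le_one_div_of_le (by positivity)
            norm_cast; omega
      have hN0 : 0 < N := by linarith
      have hth : phaseThreshold N (J + 1) ^ s ≤
          1 / ((J + 1 + 1 : ℕ) : ℝ) * N ^ (s * (1 - 1 / 100)) := by
        rw [phaseThreshold, if_neg (Nat.succ_ne_zero J),
          Real.mul_rpow (by positivity) (by positivity), ← Real.rpow_natCast_mul (by positivity),
          ← Real.rpow_mul hN0.le, mul_comm (1 - 1 / 100 : ℝ) s]
        exact mul_le_mul_of_nonneg_right (by exact_mod_cast hx) (by positivity)
      calc _ ≤ (C ^ (J + 1) / ((J + 1).factorial : ℝ) * N ^ (s * (1 + (1 - 1 / 100) * J))) *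
            (C * (1 / ((J + 1 + 1 : ℕ) : ℝ) * N ^ (s * (1 - 1 / 100)))) := by
            gcongr
            refine mul_nonneg hC (Real.rpow_nonneg ?_ _)
            linarith [one_le_phaseThreshold hN (J + 1)]
        _ = C ^ (J + 1 + 1) / ((J + 1 + 1).factorial : ℝ) *
            (N ^ (s * (1 + (1 - 1 / 100) * J)) * N ^ (s * (1 - 1 / 100))) := by
            rw [Nat.factorial_succ (J + 1)]; push_cast; field_simp; ring
        _ = _ := by
            rw [← Real.rpow_add hN0]; congr 2; push_cast; ring
  refine key.trans ?_
  gcongr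
  exact Real.pow_div_factorial_le_exp C hC _

/-- Since `n` and all inner frequencies are determined by the leaves, summing over `n` and over
all chains amounts to summing independently over the leaves. -/
theorem tsum_tsum_chain_le {h : ℤ → ENNReal} (J : ℕ) (u : ℤ → ENNReal) :
    ∑' n : ℤ, ∑' f : Fin J → ℤ × ℤ × ℤ,
      {f | ∀ j : Fin J, (f j).1 - (f j).2.1 + (f j).2.2 = ngen n f j}.indicator
        (fun f => u (alast n f) * ∏ j, (h (f j).2.1 * h (f j).2.2)) f ≤
      (∑' n, u n) * (∑' n, h n) ^ (2 * J) := by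
  induction J generalizing u with
  | zero =>
    simp only [Nat.mul_zero, pow_zero, mul_one]
    refine ENNReal.tsum_le_tsum fun n => ?_
    rw [tsum_eq_single default (fun f hf => absurd (Subsingleton.elim f default) hf)]
    refine (Set.indicator_le_self' (fun _ _ => zero_le) _).trans ?_
    simp [alast]
  | succ J ih =>
    set u' : ℤ → ENNReal := fun m => ∑' t : ℤ × ℤ × ℤ,
      {t : ℤ × ℤ × ℤ | t.1 - t.2.1 + t.2.2 = m}.indicator
        (fun t => u t.1 * (h t.2.1 * h t.2.2)) t with hu'
    have hsum : ∑' m, u' m = (∑' n, u n) * (∑' n, h n) ^ 2 := by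
      rw [hu', ENNReal.tsum_comm]
      have : ∀ t : ℤ × ℤ × ℤ, ∑' m : ℤ, {t : ℤ × ℤ × ℤ | t.1 - t.2.1 + t.2.2 = m}.indicator
          (fun t => u t.1 * (h t.2.1 * h t.2.2)) t = u t.1 * (h t.2.1 * h t.2.2) := by
        intro t
        rw [tsum_eq_single (t.1 - t.2.1 + t.2.2)]
        · rw [Set.indicator_of_mem (by exact rfl)]
        · intro m hm
          rw [Set.indicator_of_notMem (by exact fun h => hm h.symm)]
      simp_rw [this]
      rw [ENNReal.tsum_prod (f := fun a (p : ℤ × ℤ) => u a * (h p.1 * h p.2))]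
      simp_rw [ENNReal.tsum_mul_left, ENNReal.tsum_mul_right]
      rw [ENNReal.tsum_prod (f := fun b c => h b * h c)]
      simp_rw [ENNReal.tsum_mul_left, ENNReal.tsum_mul_right]
      rw [sq]
    calc _ ≤ _ := ?_
      _ ≤ _ := ih u'
      _ = _ := by rw [hsum]; ring
    refine ENNReal.tsum_le_tsum fun n => ?_
    rw [tsum_fin_succ_eq]
    refine ENNReal.tsum_le_tsum fun g => ?_
    by_cases hg : ∀ j : Fin J, (g j).1 - (g j).2.1 + (g j).2.2 = ngen n g j
    · rw [Set.indicator_of_mem (by exact hg), hu', ← ENNReal.tsum_mul_right]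
      refine ENNReal.tsum_le_tsum fun t => ?_
      by_cases ht : t.1 - t.2.1 + t.2.2 = alast n g
      · rw [Set.indicator_of_mem (s := {t : ℤ × ℤ × ℤ | _}) (by exact ht)]
        refine (Set.indicator_le_self' (fun _ _ => zero_le) _).trans (le_of_eq ?_)
        rw [alast_snoc, Fin.prod_univ_castSucc]
        simp only [Fin.snoc_castSucc, Fin.snoc_last]
        ring
      · rw [Set.indicator_of_notMem]
        · exact zero_le
        · intro hf
          have := hf (Fin.last J)
          rw [ngen_snoc_last, Fin.snoc_last] at this
          exact ht this
    · refine le_of_eq_of_le (ENNReal.tsum_eq_zero.mpr fun t => ?_) zero_le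
      apply Set.indicator_of_notMem
      intro hf
      refine hg fun j => ?_
      have := hf j.castSucc
      rwa [ngen_snoc_castSucc, Fin.snoc_castSucc] at this

theorem summable_and_tsum_le_of_tsum_ofReal_le {ι : Type*} {f : ι → ℝ} (hf : ∀ i, 0 ≤ f i)
    {K : ℝ} (hK : 0 ≤ K) (h : ∑' i, ENNReal.ofReal (f i) ≤ ENNReal.ofReal K) :
    Summable f ∧ ∑' i, f i ≤ K := by
  have hs : Summable f := by
    have := ENNReal.summable_toReal (h.trans_lt ENNReal.ofReal_lt_top).ne
    simpa only [ENNReal.toReal_ofReal (hf _)] using this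
  refine ⟨hs, ?_⟩
  rwa [← ENNReal.ofReal_tsum_of_nonneg hf hs, ENNReal.ofReal_le_ofReal_iff hK] at h

theorem summable_mul_and_sq_tsum_mul_le {ι : Type*} {f g : ι → ℝ} (hf : ∀ i, 0 ≤ f i)
    (hg : ∀ i, 0 ≤ g i) (hf2 : Summable fun i => f i ^ 2) (hg2 : Summable fun i => g i ^ 2) :
    (Summable fun i => f i * g i) ∧
      (∑' i, f i * g i) ^ 2 ≤ (∑' i, f i ^ 2) * ∑' i, g i ^ 2 := by
  obtain ⟨h1, h2⟩ := Real.summable_and_inner_le_Lp_mul_Lq_tsum_of_nonneg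
    Real.HolderConjugate.two_two hf hg (by simpa using hf2) (by simpa using hg2)
  refine ⟨h1, ?_⟩
  simp only [Real.rpow_two, ← Real.sqrt_eq_rpow] at h2
  calc _ ≤ (√(∑' i, f i ^ 2) * √(∑' i, g i ^ 2)) ^ 2 :=
        pow_le_pow_left₀ (tsum_nonneg fun i => mul_nonneg (hf i) (hg i)) h2 2
    _ = _ := by
      rw [mul_pow, Real.sq_sqrt (tsum_nonneg fun _ => sq_nonneg _),
        Real.sq_sqrt (tsum_nonneg fun _ => sq_nonneg _)]

theorem tsum_tsum_validChain_leaves_le (N : ℝ) {v : ℤ → ℂ} (hv : Memℓ2 v) (J : ℕ) :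
    ∑' n : ℤ, ∑' f : {f : Fin J → ℤ × ℤ × ℤ // validChain N n f},
      ENNReal.ofReal ((‖v (alast n f.1)‖ * ∏ j, (‖v (f.1 j).2.1‖ * ‖v (f.1 j).2.2‖)) ^ 2) ≤
      ENNReal.ofReal ((∑' n, ‖v n‖ ^ 2) ^ (2 * J + 1)) := by
  set h : ℤ → ENNReal := fun n => ENNReal.ofReal (‖v n‖ ^ 2) with hh
  have hV : ENNReal.ofReal ((∑' n, ‖v n‖ ^ 2) ^ (2 * J + 1)) =
      (∑' n, h n) * (∑' n, h n) ^ (2 * J) := by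
    rw [ENNReal.ofReal_pow (tsum_nonneg fun _ => sq_nonneg _),
      ENNReal.ofReal_tsum_of_nonneg (fun _ => sq_nonneg _) hv, pow_succ']
  rw [hV]
  refine le_trans (ENNReal.tsum_le_tsum fun n => ?_) (tsum_tsum_chain_le (h := h) J h)
  rw [show (∑' f : {f : Fin J → ℤ × ℤ × ℤ // validChain N n f},
      ENNReal.ofReal ((‖v (alast n f.1)‖ * ∏ j, (‖v (f.1 j).2.1‖ * ‖v (f.1 j).2.2‖)) ^ 2)) = _ from
    tsum_subtype {f : Fin J → ℤ × ℤ × ℤ | validChain N n f} (fun f =>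
      ENNReal.ofReal ((‖v (alast n f)‖ * ∏ j, (‖v (f j).2.1‖ * ‖v (f j).2.2‖)) ^ 2))]
  refine ENNReal.tsum_le_tsum fun f => ?_
  refine (Set.indicator_le_indicator_of_subset (fun f hf j => (hf.1 j).1)
    (fun _ => zero_le) f).trans (le_of_eq ?_)
  refine congrFun (congrArg _ (funext fun f => ?_)) f
  rw [mul_pow, ENNReal.ofReal_mul (sq_nonneg _), ← Finset.prod_pow,
    ENNReal.ofReal_prod_of_nonneg fun _ _ => sq_nonneg _]
  simp only [hh, mul_pow, ENNReal.ofReal_mul (sq_nonneg _)]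

/-- **Bound on the boundary term `N^{(J+1)}₀` of the `J`-th normal form reduction** (per-tree
estimate, first-child chain). For every `ε > 0` there is `C > 0`, independent of `J` and `N`,
such that for every `J ≥ 2`, `N ≥ 1`, `v ∈ ℓ²(ℤ;ℂ)`: `Q(n)` is finite for each `n`, belongs
to `ℓ²(ℤ)`, and `‖Q‖ ≤ C N^{−J/2 + (J−1)/200 + Jε} ‖v‖^{2J+1}`. -/
theorem NJ1_0_bound : ∀ ε > (0:ℝ), ∃ C > (0:ℝ), ∀ J : ℕ, 2 ≤ J → ∀ N : ℝ, 1 ≤ N →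
    ∀ v : ℤ → ℂ, Memℓ2 v →
    (∀ n : ℤ, Summable fun f : {f : Fin J → ℤ × ℤ × ℤ // validChain N n f} =>
      term12 v n f.1) ∧
    Summable (fun n : ℤ => Q12 N v J n ^ 2) ∧
    Real.sqrt (∑' n : ℤ, Q12 N v J n ^ 2)
      ≤ C * N ^ (-(J:ℝ)/2 + ((J:ℝ) - 1)/200 + (J:ℝ) * ε) * l2norm v ^ (2 * J + 1) := by
  intro ε hε
  set δ : ℝ := min ε (1 / 6) with hδ_def
  have hδ : 0 < δ := lt_min hε (by norm_num)
  have hδε : δ ≤ ε := min_le_left _ _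
  have hδ6 : δ ≤ 1 / 6 := min_le_right _ _
  obtain ⟨C, hC0, hC⟩ := exists_tsum_nonresonantTriples_le hδ (by linarith)
  refine ⟨√(Real.exp C), by positivity, fun J hJ N hN v hv => ?_⟩
  obtain ⟨J, rfl⟩ : ∃ J', J = J' + 1 := ⟨J - 1, by omega⟩
  have hN0 : 0 < N := by linarith
  set V : ℝ := ∑' n, ‖v n‖ ^ 2 with hV
  have hV0 : 0 ≤ V := tsum_nonneg fun _ => sq_nonneg _
  set K : ℝ := Real.exp C * N ^ (-(1 - 2 * δ) * (1 + (1 - 1 / 100) * J)) with hK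
  have hK0 : 0 ≤ K := by positivity
  have hweights : ∀ n : ℤ,
      (Summable fun f : {f : Fin (J + 1) → ℤ × ℤ × ℤ // validChain N n f} =>
        (∏ k, 1 / |((mutGen n f.1 k : ℤ) : ℝ)|) ^ 2) ∧
      ∑' f : {f : Fin (J + 1) → ℤ × ℤ × ℤ // validChain N n f},
        (∏ k, 1 / |((mutGen n f.1 k : ℤ) : ℝ)|) ^ 2 ≤ K := by
    intro n
    refine summable_and_tsum_le_of_tsum_ofReal_le (fun _ => sq_nonneg _) hK0 ?_
    have h1 := tsum_validChain_le hN hC n (J + 1)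
    rw [← ENNReal.ofReal_prod_of_nonneg fun k _ => mul_nonneg hC0.le
      (Real.rpow_nonneg (zero_le_one.trans (one_le_phaseThreshold hN k)) _)] at h1
    refine le_trans (le_of_eq ?_) (h1.trans (ENNReal.ofReal_le_ofReal
      (prod_phaseThreshold_le hN hC0.le (by linarith) J)))
    rw [← tsum_subtype]
    refine tsum_congr fun f => ?_
    rw [← Finset.prod_pow, ENNReal.ofReal_prod_of_nonneg fun _ _ => sq_nonneg _]
  set leaves : (n : ℤ) → {f : Fin (J + 1) → ℤ × ℤ × ℤ // validChain N n f} → ℝ := fun n f =>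
    ‖v (alast n f.1)‖ * ∏ j, (‖v (f.1 j).2.1‖ * ‖v (f.1 j).2.2‖) with hleaves
  have hleaves0 : ∀ n f, 0 ≤ leaves n f := fun n f => by positivity
  have hleaves_le := tsum_tsum_validChain_leaves_le N hv (J + 1)
  have hleaves_sq : ∀ n, Summable fun f => leaves n f ^ 2 := fun n =>
    (summable_and_tsum_le_of_tsum_ofReal_le (fun _ => sq_nonneg _) (by positivity)
      ((ENNReal.le_tsum n).trans hleaves_le)).1
  obtain ⟨hE, hE_le⟩ := summable_and_tsum_le_of_tsum_ofReal_le
    (f := fun n => ∑' f, leaves n f ^ 2) (K := V ^ (2 * (J + 1) + 1))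
    (fun n => tsum_nonneg fun _ => sq_nonneg _) (by positivity) (by
      simp_rw [ENNReal.ofReal_tsum_of_nonneg (fun _ => sq_nonneg _) (hleaves_sq _)]
      exact hleaves_le)
  have hCS := fun n => summable_mul_and_sq_tsum_mul_le
    (f := fun f : {f : Fin (J + 1) → ℤ × ℤ × ℤ // validChain N n f} =>
      ∏ k, 1 / |((mutGen n f.1 k : ℤ) : ℝ)|) (g := leaves n)
    (fun f => by positivity) (hleaves0 n) (hweights n).1 (hleaves_sq n)
  have hterm : ∀ n (f : {f : Fin (J + 1) → ℤ × ℤ × ℤ // validChain N n f}),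
      term12 v n f.1 = (∏ k, 1 / |((mutGen n f.1 k : ℤ) : ℝ)|) * leaves n f :=
    fun n f => mul_assoc _ _ _
  have hQ : ∀ n, Q12 N v (J + 1) n ^ 2 ≤ K * ∑' f, leaves n f ^ 2 := by
    intro n
    rw [Q12, tsum_congr (hterm n)]
    exact (hCS n).2.trans (mul_le_mul_of_nonneg_right (hweights n).2
      (tsum_nonneg fun _ => sq_nonneg _))
  have hQs : Summable fun n : ℤ => Q12 N v (J + 1) n ^ 2 :=
    Summable.of_nonneg_of_le (fun _ => sq_nonneg _) hQ (hE.mul_left K)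
  refine ⟨fun n => (hCS n).1.congr fun f => (hterm n f).symm, hQs, ?_⟩
  have hsum : ∑' n : ℤ, Q12 N v (J + 1) n ^ 2 ≤ K * V ^ (2 * (J + 1) + 1) := by
    refine (hQs.tsum_le_tsum hQ (hE.mul_left K)).trans ?_
    rw [tsum_mul_left]
    exact mul_le_mul_of_nonneg_left hE_le hK0
  refine (Real.sqrt_le_sqrt hsum).trans ?_
  have hVpow : √(V ^ (2 * (J + 1) + 1)) = l2norm v ^ (2 * (J + 1) + 1) := by
    rw [l2norm, ← hV, Real.sqrt_eq_iff_mul_self_eq (by positivity) (by positivity), ← mul_pow,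
      Real.mul_self_sqrt hV0]
  rw [Real.sqrt_mul hK0, hVpow]
  refine mul_le_mul_of_nonneg_right ?_ (pow_nonneg (Real.sqrt_nonneg _) _)
  rw [hK, Real.sqrt_mul (Real.exp_pos _).le]
  refine mul_le_mul_of_nonneg_left ?_ (Real.sqrt_nonneg _)
  rw [Real.sqrt_eq_rpow, ← Real.rpow_mul hN0.le]
  refine Real.rpow_le_rpow_of_exponent_le hN ?_
  have hJ0 : (0 : ℝ) ≤ J := Nat.cast_nonneg J
  push_cast
  nlinarith [mul_nonneg hJ0 (sub_nonneg.mpr hδε), mul_nonneg hJ0 hδ.le]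
end

section
/- For every ε > 0 there exists C > 0, independent of J and N, such that the following holds for every integer J ≥ 1, every real N ≥ 1, and every v ∈ ℓ²(ℤ; ℂ). For n ∈ ℤ consider all families of frequencies defined recursively by n^{(1)} := n and, for j = 1, …, J+1, triples (a_j, b_j, c_j) ∈ ℤ³ with a_j − b_j + c_j = n^{(j)}, b_j ∉ {a_j, c_j}, and n^{(j+1)} := a_j; set μ_j := 2(n^{(j)} − a_j)(n^{(j)} − c_j) and μ̃_j := μ₁ + ⋯ + μ_j, and impose |μ₁| > N, |μ̃_j| > (2j+1)³ · max(|μ̃_{j−1}|^{1 − 1/100}, |μ₁|^{1 − 1/100}) for j = 2, …, J, and |μ̃_{J+1}| ≤ (2J+3)³ · max(|μ̃_J|^{1 − 1/100}, |μ₁|^{1 − 1/100}). Define Q(n) := ∑ over all such families of (∏_{k=1}^{J} 1/|μ̃_k|) · |v_{a_{J+1}}| · ∏_{j=1}^{J+1} (|v_{b_j}| · |v_{c_j}|). Then Q is finite for every n, belongs to ℓ²(ℤ), and ‖Q‖ ≤ C N^{−(J−1)/2 + (J−2)/200 + (J+1)ε} ‖v‖^{2J+3}. -/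
open scoped BigOperators

/-- First-child chain of `J+1` generations for the nearly resonant term `N^{(J+1)}₁`:
structural conditions, `|μ₁| > N`, non-resonance
`|μ̃_j| > (2(j+1)+1)³ max(|μ̃_{j-1}|^{1−1/100}, |μ₁|^{1−1/100})` for the middle generations
`1 ≤ j < J` (0-indexed), and near-resonance
`|μ̃_{J}| ≤ (2J+3)³ max(|μ̃_{J-1}|^{1−1/100}, |μ₁|^{1−1/100})` for the last generation. -/
def validChain13 (N : ℝ) (n : ℤ) (J : ℕ) (f : Fin (J + 1) → ℤ × ℤ × ℤ) : Prop :=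
  (∀ j : Fin (J + 1), (f j).1 - (f j).2.1 + (f j).2.2 = ngen n f j ∧
    (f j).2.1 ≠ (f j).1 ∧ (f j).2.1 ≠ (f j).2.2) ∧
  N < |((muGen n f 0 : ℤ) : ℝ)| ∧
  (∀ j : Fin (J + 1), 1 ≤ j.1 → j.1 < J →
    ((2 * j.1 + 3 : ℕ) : ℝ) ^ 3 *
      max (|((mutGen n f ⟨j.1 - 1, lt_of_le_of_lt (Nat.sub_le _ _) j.isLt⟩ : ℤ) : ℝ)|
            ^ ((1:ℝ) - 1/100))
          (|((muGen n f 0 : ℤ) : ℝ)| ^ ((1:ℝ) - 1/100))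
      < |((mutGen n f j : ℤ) : ℝ)|) ∧
  |((mutGen n f (Fin.last J) : ℤ) : ℝ)| ≤
    ((2 * J + 3 : ℕ) : ℝ) ^ 3 *
      max (|((mutGen n f ⟨J - 1, Nat.lt_succ_of_le (Nat.sub_le _ _)⟩ : ℤ) : ℝ)|
            ^ ((1:ℝ) - 1/100))
          (|((muGen n f 0 : ℤ) : ℝ)| ^ ((1:ℝ) - 1/100))

/-- The summand `(∏_{k<J} 1/|μ̃_k|) |v_{a_{J+1}}| ∏_{j≤J} |v_{b_j}| |v_{c_j}|` of the
nearly resonant term `N^{(J+1)}₁`. -/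
noncomputable def term13 (v : ℤ → ℂ) (n : ℤ) (J : ℕ) (f : Fin (J + 1) → ℤ × ℤ × ℤ) : ℝ :=
  (∏ k : Fin J, 1 / |((mutGen n f k.castSucc : ℤ) : ℝ)|) * ‖v (f (Fin.last J)).1‖ *
    ∏ j : Fin (J + 1), (‖v (f j).2.1‖ * ‖v (f j).2.2‖)

/-- The majorant `Q(n)` of the nearly resonant term `N^{(J+1)}₁` (first-child chain tree). -/
noncomputable def Q13 (N : ℝ) (v : ℤ → ℂ) (J : ℕ) (n : ℤ) : ℝ :=
  ∑' f : {f : Fin (J + 1) → ℤ × ℤ × ℤ // validChain13 N n J f}, term13 v n J f.1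

open Finset in
/-- The divisor bound `d(n) ≪ n^δ`. -/
theorem exists_card_divisors_le_rpow {δ : ℝ} (hδ : 0 < δ) :
    ∃ C : ℝ, 0 < C ∧ ∀ n : ℕ, n ≠ 0 → (n.divisors.card : ℝ) ≤ C * (n : ℝ) ^ δ := by
  obtain ⟨P, hP⟩ := exists_nat_ge ((2 : ℝ) ^ (1 / δ))
  set K : ℝ := 1 + 2 / δ with hK
  have hK1 : 1 ≤ K := by rw [hK]; linarith [div_pos two_pos hδ]
  refine ⟨K ^ P, by positivity, fun n hn => ?_⟩
  have hfactor : ∀ p ∈ n.primeFactors, ((n.factorization p : ℝ) + 1) ≤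
      (if p < P then K else 1) * ((p : ℝ) ^ (n.factorization p)) ^ δ := by
    intro p hp
    have hp2 : (2 : ℝ) ≤ p := by exact_mod_cast (Nat.prime_of_mem_primeFactors hp).two_le
    set a := n.factorization p
    have hswap : ((p : ℝ) ^ a) ^ δ = ((p : ℝ) ^ δ) ^ a := by
      rw [← Real.rpow_natCast, ← Real.rpow_natCast, ← Real.rpow_mul (by positivity),
        ← Real.rpow_mul (by positivity), mul_comm]
    split_ifs with h
    · have h1 : 1 + (a : ℝ) * (δ / 2) ≤ ((p : ℝ) ^ a) ^ δ := by
        have hb : 1 + δ / 2 ≤ (p : ℝ) ^ δ := by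
          have hlog : (1 : ℝ) / 2 ≤ Real.log p := by
            have := Real.log_le_log two_pos hp2
            linarith [Real.log_two_gt_d9]
          have := Real.add_one_le_exp (Real.log p * δ)
          rw [Real.rpow_def_of_pos (by positivity)]
          nlinarith
        rw [hswap]
        calc 1 + (a : ℝ) * (δ / 2) ≤ (1 + δ / 2) ^ a :=
              one_add_mul_le_pow (by linarith) a
          _ ≤ _ := by gcongr
      have h2 : (a : ℝ) + 1 ≤ K * (1 + a * (δ / 2)) := by
        have : K * (1 + a * (δ / 2)) = 1 + 2 / δ + a * (δ / 2) + a := by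
          rw [hK]; field_simp; ring
        rw [this]
        have : 0 ≤ 2 / δ + a * (δ / 2) := by positivity
        linarith
      exact h2.trans (by gcongr)
    · have hpP : (2 : ℝ) ^ (1 / δ) ≤ p := hP.trans (by exact_mod_cast not_lt.mp h)
      have h2 : (2 : ℝ) ≤ (p : ℝ) ^ δ := by
        have := Real.rpow_le_rpow (by positivity) hpP hδ.le
        rwa [← Real.rpow_mul two_pos.le, one_div, inv_mul_cancel₀ hδ.ne', Real.rpow_one] at this
      rw [one_mul, hswap]
      calc (a : ℝ) + 1 ≤ 2 ^ a := by exact_mod_cast Nat.lt_two_pow_self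
        _ ≤ _ := by gcongr
  have hn' : (n : ℝ) ^ δ = ∏ p ∈ n.primeFactors, ((p : ℝ) ^ (n.factorization p)) ^ δ := by
    rw [Real.finsetProd_rpow _ _ (fun _ _ => by positivity)]
    congr 1
    conv_lhs => rw [← Nat.prod_factorization_pow_eq_self hn]
    simp [Finsupp.prod]
  rw [Nat.card_divisors hn, hn']
  push_cast
  calc ∏ p ∈ n.primeFactors, ((n.factorization p : ℝ) + 1)
      ≤ ∏ p ∈ n.primeFactors,
          (if p < P then K else 1) * ((p : ℝ) ^ (n.factorization p)) ^ δ :=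
        prod_le_prod (fun _ _ => by positivity) hfactor
    _ ≤ _ := by
        rw [prod_mul_distrib]
        gcongr
        rw [prod_ite, prod_const_one, mul_one, prod_const]
        refine pow_le_pow_right₀ hK1 ?_
        calc _ ≤ (range P).card := card_le_card (fun p hp => by simpa using (mem_filter.mp hp).2)
          _ = P := card_range P

open Classical in
/-- The indicator of the divisors `d` of `μ`, damped by `|μ|^{-δ}`. -/
noncomputable def divisorWeight (δ : ℝ) (μ d : ℤ) : ENNReal :=
  if μ ≠ 0 ∧ d ∣ μ then ENNReal.ofReal (|(μ : ℝ)| ^ (-δ)) else 0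

theorem exists_tsum_divisorWeight_le {δ : ℝ} (hδ : 0 < δ) :
    ∃ C : ENNReal, C ≠ ⊤ ∧ ∀ μ : ℤ, ∑' d, divisorWeight δ μ d ≤ C := by
  obtain ⟨C, hC, hdiv⟩ := exists_card_divisors_le_rpow hδ
  refine ⟨ENNReal.ofReal (2 * C), ENNReal.ofReal_ne_top, fun μ => ?_⟩
  rcases eq_or_ne μ 0 with rfl | hμ
  · simp [divisorWeight]
  set D := μ.natAbs.divisors
  set S : Finset ℤ := D.image (fun d : ℕ => (d : ℤ)) ∪ D.image (fun d : ℕ => -(d : ℤ))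
  have hS : S.card ≤ 2 * D.card := by
    refine (Finset.card_union_le _ _).trans ?_
    rw [two_mul]
    exact add_le_add Finset.card_image_le Finset.card_image_le
  have hmem : ∀ d ∉ S, divisorWeight δ μ d = 0 := by
    intro d hd
    rw [divisorWeight, if_neg]
    rintro ⟨-, hdvd⟩
    apply hd
    have hD : d.natAbs ∈ D := by
      simp only [D, Nat.mem_divisors]
      exact ⟨Int.natAbs_dvd_natAbs.mpr hdvd, by simpa using hμ⟩
    simp only [S, Finset.mem_union, Finset.mem_image]
    rcases Int.natAbs_eq d with h | h
    · exact Or.inl ⟨_, hD, h.symm⟩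
    · exact Or.inr ⟨_, hD, h.symm⟩
  have hle : ∀ d, divisorWeight δ μ d ≤ ENNReal.ofReal (|(μ : ℝ)| ^ (-δ)) := by
    intro d
    rw [divisorWeight]
    split_ifs <;> simp
  have hμ0 : 0 < |(μ : ℝ)| := by positivity
  rw [tsum_eq_sum hmem]
  calc ∑ d ∈ S, divisorWeight δ μ d ≤ S.card • ENNReal.ofReal (|(μ : ℝ)| ^ (-δ)) :=
        Finset.sum_le_card_nsmul _ _ _ (fun d _ => hle d)
    _ = ENNReal.ofReal (S.card * |(μ : ℝ)| ^ (-δ)) := by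
        rw [nsmul_eq_mul, ENNReal.ofReal_mul (by positivity), ENNReal.ofReal_natCast]
    _ ≤ _ := by
        apply ENNReal.ofReal_le_ofReal
        have h1 : (S.card : ℝ) ≤ 2 * D.card := by exact_mod_cast hS
        have h2 := hdiv μ.natAbs (by simpa using hμ)
        rw [Nat.cast_natAbs, Int.cast_abs] at h2
        calc (S.card : ℝ) * |(μ : ℝ)| ^ (-δ)
            ≤ (2 * (C * |(μ : ℝ)| ^ δ)) * |(μ : ℝ)| ^ (-δ) := by
              gcongr
              linarith
          _ = 2 * C * (|(μ : ℝ)| ^ δ * |(μ : ℝ)| ^ (-δ)) := by ring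
          _ = 2 * C := by
              rw [← Real.rpow_add hμ0]
              simp

/-- The summable weight `⟨x⟩^{-1-δ}` on `ℤ`. -/
noncomputable def decayWeight (δ : ℝ) (x : ℤ) : ENNReal :=
  ENNReal.ofReal ((1 + |(x : ℝ)|) ^ (-(1 + δ)))

theorem tsum_decayWeight_ne_top {δ : ℝ} (hδ : 0 < δ) : ∑' x, decayWeight δ x ≠ ⊤ := by
  have hsum := Real.summable_abs_int_rpow (b := 1 + δ) (by linarith)
  have hsum' : Summable fun x : ℤ => |(x : ℝ)| ^ (-(1 + δ)) + (if x = 0 then 1 else 0) :=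
    hsum.add (summable_of_ne_finset_zero (s := {0}) (by simp))
  refine ne_top_of_le_ne_top hsum'.tsum_ofReal_ne_top (ENNReal.tsum_le_tsum fun x => ?_)
  apply ENNReal.ofReal_le_ofReal
  split_ifs with hx
  · subst hx
    simp [Real.zero_rpow (show -δ + -1 ≠ 0 by linarith)]
  · rw [add_zero]
    have : 0 < |(x : ℝ)| := by positivity
    exact Real.rpow_le_rpow_of_nonpos this (by linarith) (by linarith)

theorem ENNReal.tsum_fin_pi_prod {α : Type*} :
    ∀ {k : ℕ} (g : Fin k → α → ENNReal),
      ∑' m : Fin k → α, ∏ j, g j (m j) = ∏ j, ∑' x, g j x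
  | 0, g => by simp [tsum_fintype]
  | k + 1, g => by
    rw [← (Fin.consEquiv fun _ => α).tsum_eq, ENNReal.tsum_prod', Fin.prod_univ_succ,
      ← ENNReal.tsum_fin_pi_prod, ← ENNReal.tsum_mul_right]
    simp_rw [← ENNReal.tsum_mul_left]
    refine tsum_congr fun x => tsum_congr fun m => ?_
    simp [Fin.consEquiv, Fin.prod_univ_succ]

theorem ENNReal.tsum_mul_sq_le {ι : Type*} (f g : ι → ENNReal) :
    (∑' i, f i * g i) ^ 2 ≤ (∑' i, f i ^ 2) * ∑' i, g i ^ 2 := by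
  have hfin : ∀ s : Finset ι, ∑ i ∈ s, f i * g i ≤
      (∑' i, f i ^ 2) ^ (1 / 2 : ℝ) * (∑' i, g i ^ 2) ^ (1 / 2 : ℝ) := by
    intro s
    refine (ENNReal.inner_le_Lp_mul_Lq s f g Real.HolderConjugate.two_two).trans ?_
    simp_rw [ENNReal.rpow_two]
    gcongr <;> exact ENNReal.sum_le_tsum s
  have h : ∑' i, f i * g i ≤
      (∑' i, f i ^ 2) ^ (1 / 2 : ℝ) * (∑' i, g i ^ 2) ^ (1 / 2 : ℝ) := by
    rw [ENNReal.tsum_eq_iSup_sum]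
    exact iSup_le hfin
  calc (∑' i, f i * g i) ^ 2
      ≤ ((∑' i, f i ^ 2) ^ (1 / 2 : ℝ) * (∑' i, g i ^ 2) ^ (1 / 2 : ℝ)) ^ 2 := by gcongr
    _ = _ := by
        rw [mul_pow, ← ENNReal.rpow_two, ← ENNReal.rpow_two, ← ENNReal.rpow_mul,
          ← ENNReal.rpow_mul]
        norm_num

/-- The accumulated phase before generation `j`, with value `0` at the root. -/
def prevPhase {J : ℕ} (m : Fin J → ℤ) (j : Fin J) : ℤ :=
  if j.1 = 0 then 0 else m ⟨j.1 - 1, lt_of_le_of_lt (Nat.sub_le _ _) j.isLt⟩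

theorem muGen_eq_mutGen_sub (n : ℤ) {J : ℕ} (f : Fin J → ℤ × ℤ × ℤ) (j : Fin J) :
    muGen n f j = mutGen n f j - prevPhase (mutGen n f) j := by
  rw [prevPhase]
  split_ifs with h
  · have : Finset.Iic j = {j} := by
      ext i
      simp only [Finset.mem_Iic, Finset.mem_singleton, Fin.le_def, Fin.ext_iff]
      omega
    simp [mutGen, this]
  · have : Finset.Iic j =
        insert j (Finset.Iic ⟨j.1 - 1, lt_of_le_of_lt (Nat.sub_le _ _) j.isLt⟩) := by
      ext i
      simp only [Finset.mem_Iic, Finset.mem_insert, Fin.le_def, Fin.ext_iff]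
      omega
    rw [mutGen, mutGen, this, Finset.sum_insert]
    · ring
    · simp only [Finset.mem_Iic, Fin.le_def]
      omega

theorem mutGen_zero (n : ℤ) {J : ℕ} (f : Fin (J + 1) → ℤ × ℤ × ℤ) :
    mutGen n f 0 = muGen n f 0 := by
  simp [muGen_eq_mutGen_sub, prevPhase]

theorem ngen_zero (n : ℤ) {J : ℕ} (f : Fin (J + 1) → ℤ × ℤ × ℤ) : ngen n f 0 = n := by
  simp [ngen]

theorem ngen_succ (n : ℤ) {J : ℕ} (f : Fin (J + 1) → ℤ × ℤ × ℤ) (j : Fin J) :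
    ngen n f j.succ = (f j.castSucc).1 := by
  simp [ngen, Fin.castSucc, Fin.castAdd, Fin.castLE]

/-- The structural conditions on a family of frequencies. -/
def IsChain13 (n : ℤ) {J : ℕ} (f : Fin J → ℤ × ℤ × ℤ) : Prop :=
  ∀ j, (f j).1 - (f j).2.1 + (f j).2.2 = ngen n f j ∧ (f j).2.1 ≠ (f j).1 ∧
    (f j).2.1 ≠ (f j).2.2

theorem IsChain13.ngen_sub_ne_zero {n : ℤ} {J : ℕ} {f : Fin J → ℤ × ℤ × ℤ}
    (hf : IsChain13 n f) (j : Fin J) : ngen n f j - (f j).1 ≠ 0 := by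
  obtain ⟨h1, -, h3⟩ := hf j
  omega

theorem IsChain13.muGen_ne_zero {n : ℤ} {J : ℕ} {f : Fin J → ℤ × ℤ × ℤ}
    (hf : IsChain13 n f) (j : Fin J) : muGen n f j ≠ 0 := by
  obtain ⟨h1, h2, -⟩ := hf j
  have : ngen n f j - (f j).2.2 ≠ 0 := by omega
  exact mul_ne_zero (mul_ne_zero two_ne_zero (hf.ngen_sub_ne_zero j)) this

/-- A chain is determined by its root, its accumulated phases and the differences
`n^{(j)} - a_j`. -/
theorem IsChain13.eq_of_phases {n : ℤ} {J : ℕ} {f g : Fin J → ℤ × ℤ × ℤ}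
    (hf : IsChain13 n f) (hg : IsChain13 n g) (hm : mutGen n f = mutGen n g)
    (hd : ∀ j, ngen n f j - (f j).1 = ngen n g j - (g j).1) : f = g := by
  have key : ∀ k, ∀ hk : k < J, f ⟨k, hk⟩ = g ⟨k, hk⟩ := by
    intro k
    induction k with
    | zero =>
      intro hk
      exact eq_of_ngen_eq hf hg hm hd _ (by simp [ngen])
    | succ k ih =>
      intro hk
      exact eq_of_ngen_eq hf hg hm hd _ (by simp [ngen, ih (by omega)])
  exact funext fun j => key j.1 j.2
where
  eq_of_ngen_eq {n : ℤ} {J : ℕ} {f g : Fin J → ℤ × ℤ × ℤ}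
      (hf : IsChain13 n f) (hg : IsChain13 n g) (hm : mutGen n f = mutGen n g)
      (hd : ∀ j, ngen n f j - (f j).1 = ngen n g j - (g j).1) (j : Fin J)
      (hn : ngen n f j = ngen n g j) : f j = g j := by
    have hdj := hd j
    have hmu : muGen n f j = muGen n g j := by
      rw [muGen_eq_mutGen_sub, muGen_eq_mutGen_sub, hm]
    have ha : (f j).1 = (g j).1 := by omega
    rw [muGen, muGen, ← hn, ← ha] at hmu
    have hc := mul_left_cancel₀ (mul_ne_zero two_ne_zero (hf.ngen_sub_ne_zero j)) hmu
    have hf1 := (hf j).1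
    have hg1 := (hg j).1
    refine Prod.ext ha (Prod.ext ?_ ?_) <;> omega

/-- A chain and its root are determined by the leaves. -/
theorem IsChain13.eq_of_leaves {n n' : ℤ} {J : ℕ} {f g : Fin (J + 1) → ℤ × ℤ × ℤ}
    (hf : IsChain13 n f) (hg : IsChain13 n' g) (hlast : (f (Fin.last J)).1 = (g (Fin.last J)).1)
    (hbc : ∀ j, (f j).2 = (g j).2) : n = n' ∧ f = g := by
  have ha : ∀ j, (f j).1 = (g j).1 := by
    intro j
    induction j using Fin.reverseInduction with
    | last => exact hlast
    | cast i ih =>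
      rw [← ngen_succ n, ← ngen_succ n', ← (hf i.succ).1, ← (hg i.succ).1, ih, hbc]
  refine ⟨?_, funext fun j => Prod.ext (ha j) (hbc j)⟩
  rw [← ngen_zero n f, ← ngen_zero n' g, ← (hf 0).1, ← (hg 0).1, ha, hbc]

/-- Weighted count of the chains issued from a fixed root. -/
theorem exists_tsum_chain_weight_le {δ : ℝ} (hδ : 0 < δ) :
    ∃ C : ENNReal, C ≠ ⊤ ∧ ∀ (J : ℕ) (n : ℤ) (p : (Fin J → ℤ × ℤ × ℤ) → Prop),
      (∀ f, p f → IsChain13 n f) →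
      ∑' f : {f // p f}, ∏ j, (decayWeight δ (mutGen n f.1 j) *
        ENNReal.ofReal (|(muGen n f.1 j : ℝ)| ^ (-δ))) ≤ C ^ J := by
  obtain ⟨C, hC, hdiv⟩ := exists_tsum_divisorWeight_le hδ
  refine ⟨(∑' x, decayWeight δ x) * C, ENNReal.mul_ne_top (tsum_decayWeight_ne_top hδ) hC,
    fun J n p hp => ?_⟩
  let G : (Fin J → ℤ) × (Fin J → ℤ) → ENNReal := fun q =>
    ∏ j, (decayWeight δ (q.1 j) * divisorWeight δ (q.1 j - prevPhase q.1 j) (q.2 j))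
  let e : {f // p f} → (Fin J → ℤ) × (Fin J → ℤ) := fun f =>
    (mutGen n f.1, fun j => ngen n f.1 j - (f.1 j).1)
  have he : Function.Injective e := by
    rintro ⟨f, hf⟩ ⟨g, hg⟩ h
    obtain ⟨h1, h2⟩ := Prod.mk.inj h
    exact Subtype.ext ((hp f hf).eq_of_phases (hp g hg) h1 (congrFun h2))
  have hG : ∀ f : {f // p f}, ∏ j, (decayWeight δ (mutGen n f.1 j) *
      ENNReal.ofReal (|(muGen n f.1 j : ℝ)| ^ (-δ))) = G (e f) := by
    intro f
    refine Finset.prod_congr rfl fun j _ => ?_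
    simp only [e]
    rw [← muGen_eq_mutGen_sub, divisorWeight, if_pos]
    refine ⟨(hp f.1 f.2).muGen_ne_zero j, ?_⟩
    rw [muGen, mul_assoc, mul_left_comm]
    exact dvd_mul_right _ _
  simp_rw [hG]
  refine (ENNReal.tsum_comp_le_tsum_of_injective he G).trans ?_
  rw [ENNReal.tsum_prod']
  calc ∑' m, ∑' d, G (m, d)
      = ∑' m : Fin J → ℤ, ∏ j, ∑' d,
          (decayWeight δ (m j) * divisorWeight δ (m j - prevPhase m j) d) :=
        tsum_congr fun m => ENNReal.tsum_fin_pi_prod (fun j d =>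
          decayWeight δ (m j) * divisorWeight δ (m j - prevPhase m j) d)
    _ ≤ ∑' m : Fin J → ℤ, ∏ j, (decayWeight δ (m j) * C) := by
        refine ENNReal.tsum_le_tsum fun m => Finset.prod_le_prod' fun j _ => ?_
        rw [ENNReal.tsum_mul_left]
        gcongr
        exact hdiv _
    _ = _ := by
        rw [ENNReal.tsum_fin_pi_prod (fun (_ : Fin J) x => decayWeight δ x * C)]
        simp [ENNReal.tsum_mul_right]

/-- The sum over all roots and chains of the product over the leaves. -/
theorem tsum_chain_leaves_le (V : ℤ → ENNReal) (J : ℕ)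
    (p : ℤ → (Fin (J + 1) → ℤ × ℤ × ℤ) → Prop) (hp : ∀ n f, p n f → IsChain13 n f) :
    ∑' n, ∑' f : {f // p n f}, (V (f.1 (Fin.last J)).1 *
      ∏ j, (V (f.1 j).2.1 * V (f.1 j).2.2)) ≤ (∑' x, V x) ^ (2 * J + 3) := by
  let G : ℤ × (Fin (J + 1) → ℤ × ℤ) → ENNReal := fun q =>
    V q.1 * ∏ j, (V (q.2 j).1 * V (q.2 j).2)
  let e : (Σ n, {f // p n f}) → ℤ × (Fin (J + 1) → ℤ × ℤ) := fun q =>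
    ((q.2.1 (Fin.last J)).1, fun j => (q.2.1 j).2)
  have he : Function.Injective e := by
    rintro ⟨n, f, hf⟩ ⟨n', g, hg⟩ h
    obtain ⟨h1, h2⟩ := Prod.mk.inj h
    obtain ⟨rfl, rfl⟩ := (hp n f hf).eq_of_leaves (hp n' g hg) h1 (congrFun h2)
    rfl
  calc _ = ∑' q, G (e q) := by rw [ENNReal.tsum_sigma']
    _ ≤ ∑' q, G q := ENNReal.tsum_comp_le_tsum_of_injective he G
    _ = (∑' x, V x) * ∏ _j : Fin (J + 1), ∑' y : ℤ × ℤ, V y.1 * V y.2 := by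
        rw [ENNReal.tsum_prod', ← ENNReal.tsum_fin_pi_prod, ← ENNReal.tsum_mul_right]
        refine tsum_congr fun x => ?_
        simp only [G]
        rw [ENNReal.tsum_mul_left]
    _ = _ := by
        have : ∑' y : ℤ × ℤ, V y.1 * V y.2 = (∑' x, V x) ^ 2 := by
          rw [ENNReal.tsum_prod']
          simp_rw [ENNReal.tsum_mul_left, ENNReal.tsum_mul_right, sq]
        rw [this, Finset.prod_const, Finset.card_univ, Fintype.card_fin]
        ring

theorem prod_rpow_mul_rpow_le {J : ℕ} {κ N : ℝ} (hκ : 1 - 1 / 100 ≤ κ) (hκ1 : κ ≤ 1) (hN : 1 ≤ N)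
    (x : Fin J → ℝ) (i : Fin J)
    (hx : ∀ k : Fin J,
      ((k.1 : ℝ) + 1) ^ 2 * N ^ (if k.1 = 0 then (1 : ℝ) else 1 - 1 / 100) ≤ x k) :
    (∏ k, x k) ^ (-κ) * x i ^ ((1 : ℝ) - 1 / 100) ≤
      (J : ℝ) ^ 2 / (J.factorial : ℝ) *
        N ^ (98 / 100 - 99 / 100 * (J : ℝ) + (1 - κ) * J) := by
  have hN0 : 0 < N := by linarith
  set A : Fin J → ℝ := fun k =>
    ((k.1 : ℝ) + 1) ^ 2 * N ^ (if k.1 = 0 then (1 : ℝ) else 1 - 1 / 100) with hA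
  have hA0 : ∀ k, 0 < A k := fun k => by simp only [hA]; positivity
  have hx0 : ∀ k, 0 < x k := fun k => (hA0 k).trans_le (hx k)
  have hsplit : ∀ y : Fin J → ℝ, (∀ k, 0 < y k) →
      (∏ k, y k) ^ (-κ) * y i ^ ((1 : ℝ) - 1 / 100) =
        y i ^ (1 - 1 / 100 - κ) * (∏ k ∈ Finset.univ.erase i, y k) ^ (-κ) := by
    intro y hy
    have hR : 0 < ∏ k ∈ Finset.univ.erase i, y k := Finset.prod_pos fun k _ => hy k
    rw [← Finset.mul_prod_erase _ _ (Finset.mem_univ i), Real.mul_rpow (hy i).le hR.le,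
      show (1 : ℝ) - 1 / 100 - κ = -κ + (1 - 1 / 100) by ring, Real.rpow_add (hy i)]
    ring
  have hmono : (∏ k, x k) ^ (-κ) * x i ^ ((1 : ℝ) - 1 / 100) ≤
      (∏ k, A k) ^ (-κ) * A i ^ ((1 : ℝ) - 1 / 100) := by
    rw [hsplit x hx0, hsplit A hA0]
    have hR : 0 < ∏ k ∈ Finset.univ.erase i, A k := Finset.prod_pos fun k _ => hA0 k
    have h1 := Real.rpow_le_rpow_of_nonpos (hA0 i) (hx i)
      (show 1 - 1 / 100 - κ ≤ 0 by linarith)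
    have h2 := Real.rpow_le_rpow_of_nonpos hR
      (Finset.prod_le_prod (fun k _ => (hA0 k).le) (fun k _ => hx k)) (show -κ ≤ 0 by linarith)
    have h3 : 0 ≤ A i ^ (1 - 1 / 100 - κ) := Real.rpow_nonneg (hA0 i).le _
    have h4 : 0 ≤ (∏ k ∈ Finset.univ.erase i, x k) ^ (-κ) :=
      Real.rpow_nonneg (Finset.prod_nonneg fun k _ => (hx0 k).le) _
    exact mul_le_mul h1 h2 h4 h3
  have hJ : 1 ≤ J := by have := i.2; omega
  have hprod : ∏ k, A k = (J.factorial : ℝ) ^ 2 * N ^ (99 / 100 * (J : ℝ) + 1 / 100) := by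
    simp only [hA]
    rw [Finset.prod_mul_distrib, Finset.prod_pow]
    congr 2
    · rw [Fin.prod_univ_eq_prod_range (fun k => (k : ℝ) + 1) J,
        ← Finset.prod_range_add_one_eq_factorial]
      push_cast
      rfl
    · obtain ⟨J, rfl⟩ := Nat.exists_eq_add_of_le' hJ
      rw [Fin.prod_univ_succ]
      simp only [Fin.val_zero, if_true, Fin.val_succ, Nat.add_eq_zero_iff, one_ne_zero, and_false,
        if_false, Finset.prod_const, Finset.card_univ, Fintype.card_fin]
      rw [← Real.rpow_natCast, ← Real.rpow_mul hN0.le, ← Real.rpow_add hN0]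
      congr 1
      push_cast
      ring
  have hAi : A i ^ ((1 : ℝ) - 1 / 100) ≤ (J : ℝ) ^ 2 * N ^ (99 / 100 : ℝ) := by
    have hJ1 : (1 : ℝ) ≤ J := by exact_mod_cast hJ
    have hle : A i ≤ (J : ℝ) ^ 2 * N := by
      simp only [hA]
      have h1 : ((i.1 : ℝ) + 1) ≤ J := by exact_mod_cast i.2
      have h2 : N ^ (if i.1 = 0 then (1 : ℝ) else 1 - 1 / 100) ≤ N := by
        conv_rhs => rw [← Real.rpow_one N]
        apply Real.rpow_le_rpow_of_exponent_le hN
        split_ifs <;> norm_num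
      gcongr
    calc A i ^ ((1 : ℝ) - 1 / 100) ≤ ((J : ℝ) ^ 2 * N) ^ ((1 : ℝ) - 1 / 100) :=
          Real.rpow_le_rpow (hA0 i).le hle (by norm_num)
      _ = ((J : ℝ) ^ 2) ^ ((1 : ℝ) - 1 / 100) * N ^ ((1 : ℝ) - 1 / 100) :=
          Real.mul_rpow (by positivity) hN0.le
      _ ≤ (J : ℝ) ^ 2 * N ^ (99 / 100 : ℝ) := by
          have h1 : ((J : ℝ) ^ 2) ^ ((1 : ℝ) - 1 / 100) ≤ (J : ℝ) ^ 2 :=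
            Real.rpow_le_self_of_one_le (one_le_pow₀ hJ1) (by norm_num)
          rw [show (1 : ℝ) - 1 / 100 = 99 / 100 by norm_num] at h1 ⊢
          gcongr
  have hfac : ((J.factorial : ℝ) ^ 2) ^ (-κ) ≤ (J.factorial : ℝ)⁻¹ := by
    have h1 : (1 : ℝ) ≤ J.factorial := by exact_mod_cast J.factorial_pos
    rw [← Real.rpow_natCast, ← Real.rpow_mul (by positivity), ← Real.rpow_neg_one]
    apply Real.rpow_le_rpow_of_exponent_le h1
    push_cast
    linarith
  have hNpow : (N ^ (99 / 100 * (J : ℝ) + 1 / 100)) ^ (-κ) * N ^ (99 / 100 : ℝ) ≤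
      N ^ (98 / 100 - 99 / 100 * (J : ℝ) + (1 - κ) * J) := by
    rw [← Real.rpow_mul hN0.le, ← Real.rpow_add hN0]
    apply Real.rpow_le_rpow_of_exponent_le hN
    have hJ1 : (1 : ℝ) ≤ J := by exact_mod_cast hJ
    nlinarith
  refine hmono.trans ?_
  rw [hprod, Real.mul_rpow (by positivity) (by positivity)]
  calc ((J.factorial : ℝ) ^ 2) ^ (-κ) * (N ^ (99 / 100 * (J : ℝ) + 1 / 100)) ^ (-κ) *
        A i ^ ((1 : ℝ) - 1 / 100)
      ≤ (J.factorial : ℝ)⁻¹ * (N ^ (99 / 100 * (J : ℝ) + 1 / 100)) ^ (-κ) *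
        ((J : ℝ) ^ 2 * N ^ (99 / 100 : ℝ)) := by
        gcongr
    _ = (J : ℝ) ^ 2 / J.factorial *
        ((N ^ (99 / 100 * (J : ℝ) + 1 / 100)) ^ (-κ) * N ^ (99 / 100 : ℝ)) := by
        field_simp
    _ ≤ _ := by gcongr

theorem one_div_sq_le_of_le {P Y M T z D δ : ℝ} (hP : 1 ≤ P) (hY : 1 ≤ Y) (hM : 0 < M)
    (hMY : M ≤ Y ^ 2) (hT : 1 ≤ T) (hz : 0 ≤ z) (hYT : Y ≤ T * P * z) (hzP : z ≤ P)
    (hδ : 0 < δ) (hδ1 : δ ≤ 1 / 3) (hD : P ^ (-(1 - 6 * δ)) * z ≤ D) :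
    (1 / P) ^ 2 ≤ T ^ 2 * D * (Y ^ (-(1 + δ)) * M ^ (-δ)) := by
  have hP0 : 0 < P := by linarith
  have hY0 : 0 < Y := by linarith
  have hT0 : 0 < T := by linarith
  have hM' : M ^ δ ≤ Y ^ (2 * δ) := by
    calc M ^ δ ≤ (Y ^ 2) ^ δ := Real.rpow_le_rpow hM.le hMY hδ.le
      _ = _ := by rw [← Real.rpow_natCast, ← Real.rpow_mul hY0.le]; norm_num
  have hY3 : Y ^ (3 * δ) ≤ T * P ^ (6 * δ) := by
    have hle : Y ≤ T * P ^ 2 := hYT.trans (by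
      rw [sq, ← mul_assoc]
      gcongr)
    calc Y ^ (3 * δ) ≤ (T * P ^ 2) ^ (3 * δ) := Real.rpow_le_rpow hY0.le hle (by positivity)
      _ = T ^ (3 * δ) * P ^ (6 * δ) := by
          rw [Real.mul_rpow hT0.le (by positivity), ← Real.rpow_natCast, ← Real.rpow_mul hP0.le]
          congr 2
          push_cast
          ring
      _ ≤ _ := by
          gcongr
          exact Real.rpow_le_self_of_one_le hT (by linarith)
  have hmain : Y ^ (1 + δ) * M ^ δ ≤ P ^ 2 * (T ^ 2 * D) := by
    calc Y ^ (1 + δ) * M ^ δ ≤ Y ^ (1 + δ) * Y ^ (2 * δ) := by gcongr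
      _ = Y * Y ^ (3 * δ) := by
          rw [← Real.rpow_add hY0, show 1 + δ + 2 * δ = 1 + 3 * δ by ring, Real.rpow_add hY0,
            Real.rpow_one]
      _ ≤ (T * P * z) * (T * P ^ (6 * δ)) := by gcongr
      _ = P ^ 2 * (T ^ 2 * (P ^ (-(1 - 6 * δ)) * z)) := by
          rw [show -(1 - 6 * δ) = 6 * δ - 1 by ring, Real.rpow_sub hP0, Real.rpow_one]
          field_simp
      _ ≤ _ := by gcongr
  rw [Real.rpow_neg hY0.le, Real.rpow_neg hM.le, ← mul_inv, ← div_eq_mul_inv,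
    le_div_iff₀ (by positivity), one_div, inv_pow, inv_mul_le_iff₀ (by positivity)]
  exact hmain

theorem exists_const_le (C : ℝ) (hC : 0 ≤ C) : ∃ K : ℝ, 0 < K ∧ ∀ J : ℕ,
    ((2 : ℝ) ^ (J + 1) * (2 * J + 3) ^ 3) ^ 2 * ((J : ℝ) ^ 2 / (J.factorial : ℝ)) * C ^ (J + 1)
      ≤ K := by
  have he : 0 < Real.exp 1 := Real.exp_pos 1
  refine ⟨4 * C * (Nat.factorial 8) * Real.exp 1 ^ 3 * Real.exp (4 * C * Real.exp 1 ^ 2) + 1,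
    by positivity, fun J => ?_⟩
  have h1 : ((2 * J + 3 : ℝ)) ^ 8 ≤ Nat.factorial 8 * Real.exp 1 ^ (2 * J + 3) := by
    have := Real.pow_div_factorial_le_exp (2 * J + 3) (by positivity) 8
    rw [div_le_iff₀ (by positivity)] at this
    rw [← Real.exp_nat_mul]
    push_cast
    rw [mul_one, mul_comm _ (Real.exp _)]
    exact this
  have h2 := Real.pow_div_factorial_le_exp (4 * C * Real.exp 1 ^ 2) (by positivity) J
  have h3 : (J : ℝ) ^ 2 ≤ (2 * J + 3) ^ 2 := by
    gcongr
    linarith [(Nat.cast_nonneg J : (0 : ℝ) ≤ J)]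
  calc ((2 : ℝ) ^ (J + 1) * (2 * J + 3) ^ 3) ^ 2 * ((J : ℝ) ^ 2 / (J.factorial : ℝ)) * C ^ (J + 1)
      ≤ ((2 : ℝ) ^ (J + 1) * (2 * J + 3) ^ 3) ^ 2 * ((2 * J + 3 : ℝ) ^ 2 / (J.factorial : ℝ)) *
          C ^ (J + 1) := by gcongr
    _ = ((2 : ℝ) ^ (J + 1)) ^ 2 * (2 * J + 3 : ℝ) ^ 8 / (J.factorial : ℝ) * C ^ (J + 1) := by ring
    _ ≤ ((2 : ℝ) ^ (J + 1)) ^ 2 * (Nat.factorial 8 * Real.exp 1 ^ (2 * J + 3)) /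
          (J.factorial : ℝ) * C ^ (J + 1) := by gcongr
    _ = 4 * C * (Nat.factorial 8) * Real.exp 1 ^ 3 *
          ((4 * C * Real.exp 1 ^ 2) ^ J / (J.factorial : ℝ)) := by
        have : (4 : ℝ) ^ J = (2 ^ J) ^ 2 := by rw [← pow_mul, mul_comm, pow_mul]; norm_num
        rw [mul_pow, mul_pow, this]
        ring
    _ ≤ 4 * C * (Nat.factorial 8) * Real.exp 1 ^ 3 * Real.exp (4 * C * Real.exp 1 ^ 2) := by
        gcongr
    _ ≤ _ := by linarith

theorem prod_abs_muGen_le (n : ℤ) {J : ℕ} (f : Fin (J + 1) → ℤ × ℤ × ℤ) :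
    ∏ j, |(muGen n f j : ℝ)| ≤ (∏ j, (1 + |(mutGen n f j : ℝ)|)) ^ 2 := by
  set m := mutGen n f with hm
  have hprev : ∏ j, (1 + |(prevPhase m j : ℝ)|) ≤ ∏ j, (1 + |(m j : ℝ)|) := by
    rw [Fin.prod_univ_succ, Fin.prod_univ_castSucc (fun j => 1 + |(m j : ℝ)|)]
    have h0 : prevPhase m 0 = 0 := by simp [prevPhase]
    have hs : ∀ k : Fin J, prevPhase m k.succ = m k.castSucc := by
      intro k
      simp [prevPhase, Fin.castSucc, Fin.castAdd, Fin.castLE]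
    simp_rw [hs, h0, Int.cast_zero, abs_zero, add_zero, one_mul]
    exact le_mul_of_one_le_right (Finset.prod_nonneg fun _ _ => by positivity)
      (by linarith [abs_nonneg (m (Fin.last J) : ℝ)])
  calc ∏ j, |(muGen n f j : ℝ)|
      ≤ ∏ j, ((1 + |(m j : ℝ)|) * (1 + |(prevPhase m j : ℝ)|)) := by
        refine Finset.prod_le_prod (fun _ _ => abs_nonneg _) fun j _ => ?_
        rw [muGen_eq_mutGen_sub, ← hm, Int.cast_sub]
        have h1 := abs_sub (m j : ℝ) (prevPhase m j : ℝ)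
        nlinarith [mul_nonneg (abs_nonneg (m j : ℝ)) (abs_nonneg (prevPhase m j : ℝ))]
    _ ≤ _ := by
        rw [Finset.prod_mul_distrib, sq]
        exact mul_le_mul_of_nonneg_left hprev (Finset.prod_nonneg fun _ _ => by positivity)

theorem validChain13.isChain {N : ℝ} {n : ℤ} {J : ℕ} {f : Fin (J + 1) → ℤ × ℤ × ℤ}
    (hf : validChain13 N n J f) : IsChain13 n f := hf.1

theorem validChain13.le_abs_mutGen {N : ℝ} (hN : 1 ≤ N) {n : ℤ} {J : ℕ}
    {f : Fin (J + 1) → ℤ × ℤ × ℤ} (hf : validChain13 N n J f) (k : Fin J) :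
    ((k.1 : ℝ) + 1) ^ 2 * N ^ (if k.1 = 0 then (1 : ℝ) else 1 - 1 / 100) ≤
      |(mutGen n f k.castSucc : ℝ)| := by
  obtain ⟨-, h0, hmid, -⟩ := hf
  split_ifs with hk
  · have : k.castSucc = 0 := Fin.ext hk
    rw [this, mutGen_zero, hk]
    simpa using h0.le
  · refine le_trans ?_ (hmid k.castSucc (Nat.one_le_iff_ne_zero.mpr hk) k.2).le
    have hk0 : (0 : ℝ) ≤ k.1 := Nat.cast_nonneg _
    have h1 : ((k.1 : ℝ) + 1) ^ 2 ≤ ((2 * k.castSucc.1 + 3 : ℕ) : ℝ) ^ 3 := by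
      rw [Fin.val_castSucc]
      push_cast
      calc ((k.1 : ℝ) + 1) ^ 2 ≤ (2 * (k.1 : ℝ) + 3) ^ 2 := by gcongr <;> linarith
        _ ≤ _ := pow_le_pow_right₀ (by linarith) (by norm_num)
    have h2 : N ^ ((1 : ℝ) - 1 / 100) ≤ |(muGen n f 0 : ℝ)| ^ ((1 : ℝ) - 1 / 100) :=
      Real.rpow_le_rpow (by linarith) h0.le (by norm_num)
    exact mul_le_mul h1 (h2.trans (le_max_right _ _)) (by positivity) (by positivity)

theorem validChain13.exists_abs_mutGen_last_le {N : ℝ} {n : ℤ} {J : ℕ} (hJ : 1 ≤ J)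
    {f : Fin (J + 1) → ℤ × ℤ × ℤ} (hf : validChain13 N n J f) :
    ∃ i : Fin J, |(mutGen n f (Fin.last J) : ℝ)| ≤
      (2 * J + 3) ^ 3 * |(mutGen n f i.castSucc : ℝ)| ^ ((1 : ℝ) - 1 / 100) := by
  have hlast := hf.2.2.2
  push_cast at hlast
  rcases max_choice
    (|((mutGen n f ⟨J - 1, Nat.lt_succ_of_le (Nat.sub_le _ _)⟩ : ℤ) : ℝ)| ^ ((1 : ℝ) - 1 / 100))
    (|((muGen n f 0 : ℤ) : ℝ)| ^ ((1 : ℝ) - 1 / 100)) with h | h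
  · rw [h] at hlast
    exact ⟨⟨J - 1, by omega⟩, hlast⟩
  · rw [h, ← mutGen_zero] at hlast
    exact ⟨⟨0, hJ⟩, hlast⟩

theorem validChain13.weight_sq_le {N δ : ℝ} (hN : 1 ≤ N) (hδ : 0 < δ) (hδ1 : δ ≤ 1 / 600)
    {n : ℤ} {J : ℕ} (hJ : 1 ≤ J) {f : Fin (J + 1) → ℤ × ℤ × ℤ} (hf : validChain13 N n J f) :
    (∏ k : Fin J, 1 / |(mutGen n f k.castSucc : ℝ)|) ^ 2 ≤
      ((2 : ℝ) ^ (J + 1) * (2 * J + 3) ^ 3) ^ 2 * ((J : ℝ) ^ 2 / (J.factorial : ℝ) *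
        N ^ (98 / 100 - 99 / 100 * (J : ℝ) + 6 * δ * J)) *
      ∏ j, ((1 + |(mutGen n f j : ℝ)|) ^ (-(1 + δ)) * |(muGen n f j : ℝ)| ^ (-δ)) := by
  set x : Fin J → ℝ := fun k => |(mutGen n f k.castSucc : ℝ)| with hx
  have hxA := hf.le_abs_mutGen hN
  have hx1 : ∀ k, 1 ≤ x k := by
    refine fun k => le_trans ?_ (hxA k)
    refine one_le_mul_of_one_le_of_one_le (one_le_pow₀ (by simp)) (Real.one_le_rpow hN ?_)
    split_ifs <;> norm_num
  have hP1 : ∀ s : Finset (Fin J), 1 ≤ ∏ k ∈ s, x k := fun s =>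
    Finset.one_le_prod fun k _ => hx1 k
  obtain ⟨i, hi⟩ := hf.exists_abs_mutGen_last_le hJ
  have hz1 : 1 ≤ x i ^ ((1 : ℝ) - 1 / 100) := Real.one_le_rpow (hx1 i) (by norm_num)
  have hzP : x i ^ ((1 : ℝ) - 1 / 100) ≤ ∏ k, x k := by
    rw [← Finset.mul_prod_erase _ _ (Finset.mem_univ i)]
    exact (Real.rpow_le_self_of_one_le (hx1 i) (by norm_num)).trans
      (le_mul_of_one_le_right (by linarith [hx1 i]) (hP1 _))
  have hL1 : (1 : ℝ) ≤ (2 * J + 3) ^ 3 := one_le_pow₀ (by linarith [(Nat.cast_nonneg J : (0:ℝ) ≤ J)])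
  have hYT : ∏ j, (1 + |(mutGen n f j : ℝ)|) ≤
      ((2 : ℝ) ^ (J + 1) * (2 * J + 3) ^ 3) * (∏ k, x k) * x i ^ ((1 : ℝ) - 1 / 100) := by
    rw [Fin.prod_univ_castSucc]
    have h1 : ∏ k : Fin J, (1 + |(mutGen n f k.castSucc : ℝ)|) ≤ 2 ^ J * ∏ k, x k := by
      calc _ ≤ ∏ k, (2 * x k) :=
            Finset.prod_le_prod (fun _ _ => by positivity) fun k _ => by
              have := hx1 k
              simp only [hx] at this ⊢
              linarith
        _ = _ := by simp [Finset.prod_mul_distrib]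
    have h2 : 1 + |(mutGen n f (Fin.last J) : ℝ)| ≤
        2 * ((2 * J + 3) ^ 3 * x i ^ ((1 : ℝ) - 1 / 100)) := by
      have : 1 ≤ ((2 * J + 3 : ℝ)) ^ 3 * x i ^ ((1 : ℝ) - 1 / 100) :=
        one_le_mul_of_one_le_of_one_le hL1 hz1
      linarith
    calc _ ≤ (2 ^ J * ∏ k, x k) * (2 * ((2 * J + 3) ^ 3 * x i ^ ((1 : ℝ) - 1 / 100))) :=
          mul_le_mul h1 h2 (by positivity) (by have := hP1 Finset.univ; positivity)
      _ = _ := by ring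
  have hw : ∏ k : Fin J, 1 / |(mutGen n f k.castSucc : ℝ)| = 1 / ∏ k, x k := by
    simp [hx, Finset.prod_inv_distrib]
  have hD := prod_rpow_mul_rpow_le (κ := 1 - 6 * δ) (by linarith) (by linarith) hN x i hxA
  rw [show (1 : ℝ) - (1 - 6 * δ) = 6 * δ by ring] at hD
  rw [hw, Finset.prod_mul_distrib, Real.finsetProd_rpow _ _ (fun _ _ => by positivity),
    Real.finsetProd_rpow _ _ (fun _ _ => by positivity)]
  refine one_div_sq_le_of_le (hP1 _) ?_ ?_ (prod_abs_muGen_le n f) ?_ (by linarith) hYT hzP hδ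
    (by linarith) hD
  · exact Finset.one_le_prod fun j _ => by linarith [abs_nonneg (mutGen n f j : ℝ)]
  · refine Finset.prod_pos fun j _ => abs_pos.mpr ?_
    exact_mod_cast hf.isChain.muGen_ne_zero j
  · exact one_le_mul_of_one_le_of_one_le (one_le_pow₀ (by norm_num)) hL1

/-- Uniform bound, over the roots, of the square sum of the weights. -/
theorem exists_tsum_weight_sq_le {δ : ℝ} (hδ : 0 < δ) (hδ1 : δ ≤ 1 / 600) :
    ∃ K : ℝ, 0 < K ∧ ∀ J : ℕ, 1 ≤ J → ∀ N : ℝ, 1 ≤ N → ∀ n : ℤ,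
      ∑' f : {f : Fin (J + 1) → ℤ × ℤ × ℤ // validChain13 N n J f},
        ENNReal.ofReal (∏ k : Fin J, 1 / |(mutGen n f.1 k.castSucc : ℝ)|) ^ 2 ≤
      ENNReal.ofReal (K * N ^ (98 / 100 - 99 / 100 * (J : ℝ) + 6 * δ * J)) := by
  obtain ⟨C, hC, hchain⟩ := exists_tsum_chain_weight_le hδ
  obtain ⟨K, hK, hconst⟩ := exists_const_le C.toReal ENNReal.toReal_nonneg
  refine ⟨K, hK, fun J hJ N hN n => ?_⟩
  have hN0 : 0 < N := by linarith
  set e := 98 / 100 - 99 / 100 * (J : ℝ) + 6 * δ * J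
  set B : ℝ := ((2 : ℝ) ^ (J + 1) * (2 * J + 3) ^ 3) ^ 2 *
    ((J : ℝ) ^ 2 / (J.factorial : ℝ) * N ^ e) with hB
  have hB0 : 0 ≤ B := by positivity
  calc _ ≤ ∑' f : {f : Fin (J + 1) → ℤ × ℤ × ℤ // validChain13 N n J f}, ENNReal.ofReal B *
        ∏ j, (decayWeight δ (mutGen n f.1 j) *
          ENNReal.ofReal (|(muGen n f.1 j : ℝ)| ^ (-δ))) := by
        refine ENNReal.tsum_le_tsum fun f => ?_
        have := ENNReal.ofReal_le_ofReal (f.2.weight_sq_le hN hδ hδ1 hJ)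
        rw [ENNReal.ofReal_pow (Finset.prod_nonneg fun _ _ => by positivity),
          ENNReal.ofReal_mul hB0, ENNReal.ofReal_prod_of_nonneg (s := Finset.univ)
            (f := fun j => (1 + |(mutGen n f.1 j : ℝ)|) ^ (-(1 + δ)) *
              |(muGen n f.1 j : ℝ)| ^ (-δ)) (fun _ _ => by positivity)] at this
        refine this.trans_eq ?_
        congr 1
        refine Finset.prod_congr rfl fun j _ => ?_
        rw [ENNReal.ofReal_mul (by positivity), decayWeight]
    _ ≤ ENNReal.ofReal B * C ^ (J + 1) := by
        rw [ENNReal.tsum_mul_left]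
        gcongr
        exact hchain (J + 1) n _ fun f hf => hf.isChain
    _ = ENNReal.ofReal (B * C.toReal ^ (J + 1)) := by
        rw [ENNReal.ofReal_mul hB0, ENNReal.ofReal_pow ENNReal.toReal_nonneg,
          ENNReal.ofReal_toReal hC]
    _ ≤ _ := by
        apply ENNReal.ofReal_le_ofReal
        calc B * C.toReal ^ (J + 1) = ((2 : ℝ) ^ (J + 1) * (2 * J + 3) ^ 3) ^ 2 *
              ((J : ℝ) ^ 2 / (J.factorial : ℝ)) * C.toReal ^ (J + 1) * N ^ e := by
              rw [hB]; ring
          _ ≤ _ := by gcongr; exact hconst J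

theorem term13_nonneg (v : ℤ → ℂ) (n : ℤ) (J : ℕ) (f : Fin (J + 1) → ℤ × ℤ × ℤ) :
    0 ≤ term13 v n J f :=
  mul_nonneg (mul_nonneg (Finset.prod_nonneg fun _ _ => by positivity) (norm_nonneg _))
    (Finset.prod_nonneg fun _ _ => by positivity)

/-- The square sum of the majorant, as an extended nonnegative real, is at most the uniform
square sum of the weights times a power of the square sum of `v`. -/
theorem tsum_sq_tsum_term13_le {v : ℤ → ℂ} (hv : Memℓ2 v) {N R : ℝ} {J : ℕ}
    (hR : ∀ n : ℤ, ∑' f : {f : Fin (J + 1) → ℤ × ℤ × ℤ // validChain13 N n J f},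
      ENNReal.ofReal (∏ k : Fin J, 1 / |(mutGen n f.1 k.castSucc : ℝ)|) ^ 2 ≤ ENNReal.ofReal R)
    (hR0 : 0 ≤ R) :
    ∑' n : ℤ, (∑' f : {f : Fin (J + 1) → ℤ × ℤ × ℤ // validChain13 N n J f},
      ENNReal.ofReal (term13 v n J f.1)) ^ 2 ≤
        ENNReal.ofReal (R * (∑' n, ‖v n‖ ^ 2) ^ (2 * J + 3)) := by
  set V : ℤ → ENNReal := fun n => ENNReal.ofReal (‖v n‖ ^ 2) with hV
  have hS0 : 0 ≤ ∑' n, ‖v n‖ ^ 2 := tsum_nonneg fun _ => by positivity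
  have hVsum : ∑' n, V n = ENNReal.ofReal (∑' n, ‖v n‖ ^ 2) :=
    (ENNReal.ofReal_tsum_of_nonneg (fun _ => by positivity) hv).symm
  have hsplit : ∀ n (f : Fin (J + 1) → ℤ × ℤ × ℤ), ENNReal.ofReal (term13 v n J f) =
      ENNReal.ofReal (∏ k : Fin J, 1 / |(mutGen n f k.castSucc : ℝ)|) *
        ENNReal.ofReal (‖v (f (Fin.last J)).1‖ *
          ∏ j : Fin (J + 1), (‖v (f j).2.1‖ * ‖v (f j).2.2‖)) := by
    intro n f
    rw [term13, mul_assoc, ENNReal.ofReal_mul (Finset.prod_nonneg fun _ _ => by positivity)]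
  have hleaf : ∀ f : Fin (J + 1) → ℤ × ℤ × ℤ, ENNReal.ofReal (‖v (f (Fin.last J)).1‖ *
      ∏ j : Fin (J + 1), (‖v (f j).2.1‖ * ‖v (f j).2.2‖)) ^ 2 =
      V (f (Fin.last J)).1 * ∏ j, (V (f j).2.1 * V (f j).2.2) := by
    intro f
    rw [ENNReal.ofReal_mul (norm_nonneg _),
      ENNReal.ofReal_prod_of_nonneg (fun _ _ => by positivity), mul_pow, ← Finset.prod_pow]
    simp only [hV, ENNReal.ofReal_mul (norm_nonneg _), ENNReal.ofReal_pow (norm_nonneg _), mul_pow]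
  calc _ ≤ ∑' n : ℤ, ENNReal.ofReal R *
        ∑' f : {f : Fin (J + 1) → ℤ × ℤ × ℤ // validChain13 N n J f},
          (V (f.1 (Fin.last J)).1 * ∏ j, (V (f.1 j).2.1 * V (f.1 j).2.2)) := by
        refine ENNReal.tsum_le_tsum fun n => ?_
        simp_rw [hsplit]
        refine (ENNReal.tsum_mul_sq_le _ _).trans ?_
        simp_rw [hleaf]
        gcongr
        exact hR n
    _ ≤ ENNReal.ofReal R * (∑' n, V n) ^ (2 * J + 3) := by
        rw [ENNReal.tsum_mul_left]
        gcongr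
        exact tsum_chain_leaves_le V J _ fun n f hf => hf.isChain
    _ = _ := by
        rw [hVsum, ENNReal.ofReal_mul hR0, ENNReal.ofReal_pow hS0]

/-- **Bound on the nearly resonant term `N^{(J+1)}₁` of the `(J+1)`-st generation** (per-tree
estimate, first-child chain). For every `ε > 0` there is `C > 0`, independent of `J` and `N`,
such that for every `J ≥ 1`, `N ≥ 1`, `v ∈ ℓ²(ℤ;ℂ)`: `Q(n)` is finite for each `n`, belongs
to `ℓ²(ℤ)`, and `‖Q‖ ≤ C N^{−(J−1)/2 + (J−2)/200 + (J+1)ε} ‖v‖^{2J+3}`. -/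
theorem NJ1_1_bound : ∀ ε > (0:ℝ), ∃ C > (0:ℝ), ∀ J : ℕ, 1 ≤ J → ∀ N : ℝ, 1 ≤ N →
    ∀ v : ℤ → ℂ, Memℓ2 v →
    (∀ n : ℤ, Summable fun f : {f : Fin (J + 1) → ℤ × ℤ × ℤ // validChain13 N n J f} =>
      term13 v n J f.1) ∧
    Summable (fun n : ℤ => Q13 N v J n ^ 2) ∧
    Real.sqrt (∑' n : ℤ, Q13 N v J n ^ 2)
      ≤ C * N ^ (-((J:ℝ) - 1)/2 + ((J:ℝ) - 2)/200 + ((J:ℝ) + 1) * ε) *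
        l2norm v ^ (2 * J + 3) := by
  intro ε hε
  set δ : ℝ := min (ε / 3) (1 / 600) with hδdef
  have hδ : 0 < δ := lt_min (by positivity) (by norm_num)
  have hδε : δ ≤ ε / 3 := min_le_left _ _
  obtain ⟨K, hK, hweight⟩ := exists_tsum_weight_sq_le hδ (min_le_right _ _)
  refine ⟨Real.sqrt K, Real.sqrt_pos.mpr hK, fun J hJ N hN v hv => ?_⟩
  have hN0 : 0 < N := by linarith
  set e := 98 / 100 - 99 / 100 * (J : ℝ) + 6 * δ * J with he
  have hS0 : 0 ≤ ∑' n, ‖v n‖ ^ 2 := tsum_nonneg fun _ => by positivity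
  set R : ℝ := K * N ^ e * (∑' n, ‖v n‖ ^ 2) ^ (2 * J + 3) with hR
  have hR0 : 0 ≤ R := by positivity
  set q : ℤ → ENNReal := fun n =>
    ∑' f : {f : Fin (J + 1) → ℤ × ℤ × ℤ // validChain13 N n J f},
      ENNReal.ofReal (term13 v n J f.1) with hq
  have hqle : ∑' n, q n ^ 2 ≤ ENNReal.ofReal R :=
    tsum_sq_tsum_term13_le hv (hweight J hJ N hN) (by positivity)
  have hqsum : ∑' n, q n ^ 2 ≠ ⊤ := ne_top_of_le_ne_top ENNReal.ofReal_ne_top hqle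
  have hqtop : ∀ n, q n ≠ ⊤ := fun n h =>
    ENNReal.ne_top_of_tsum_ne_top hqsum n (by simp [h])
  have hQ : ∀ n, Q13 N v J n = (q n).toReal := by
    intro n
    rw [hq, ENNReal.tsum_toReal_eq (fun _ => ENNReal.ofReal_ne_top), Q13]
    simp_rw [ENNReal.toReal_ofReal (term13_nonneg v n J _)]
  have hQ2 : ∀ n, Q13 N v J n ^ 2 = (q n ^ 2).toReal := by
    intro n
    rw [hQ, ENNReal.toReal_pow]
  refine ⟨fun n => ?_, ?_, ?_⟩
  · have := ENNReal.summable_toReal (hqtop n)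
    simpa only [ENNReal.toReal_ofReal (term13_nonneg v n J _)] using this
  · simp_rw [hQ2]
    exact ENNReal.summable_toReal hqsum
  · simp_rw [hQ2]
    rw [← ENNReal.tsum_toReal_eq (ENNReal.ne_top_of_tsum_ne_top hqsum)]
    have hle : (∑' n, q n ^ 2).toReal ≤ R := ENNReal.toReal_le_of_le_ofReal hR0 hqle
    refine (Real.sqrt_le_sqrt hle).trans ?_
    have hJ1 : (1 : ℝ) ≤ J := by exact_mod_cast hJ
    have hl : l2norm v ^ 2 = ∑' n, ‖v n‖ ^ 2 := Real.sq_sqrt hS0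
    have hl0 : 0 ≤ l2norm v := Real.sqrt_nonneg _
    have hexp : N ^ e ≤
        (N ^ (-((J : ℝ) - 1) / 2 + ((J : ℝ) - 2) / 200 + ((J : ℝ) + 1) * ε)) ^ 2 := by
      rw [← Real.rpow_natCast, ← Real.rpow_mul hN0.le]
      apply Real.rpow_le_rpow_of_exponent_le hN
      rw [he]
      push_cast
      nlinarith
    refine Real.sqrt_le_iff.mpr ⟨by positivity, ?_⟩
    rw [mul_pow, mul_pow, Real.sq_sqrt hK.le, ← pow_mul, mul_comm (2 * J + 3) 2, pow_mul, hl, hR]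
    gcongr
end
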